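/- arXiv:1912.11763 — 3 statements merged into one kernel-verified Lean document; each statement's English description precedes it below -/
import Mathlib

section
/- Let h be a Hessenberg function for type A_{n−1}. For each Hessenberg function h' for type A_{n−1} with h'(i) ≤ h(i) for all i, let P_{h'} denote the class of ∏_{i=1}^{n−1} ∏_{j=h'(i)+1}^{h(i)} (x_i−x_j) in R^{A}_{h} (this class equals, up to a nonzero scalar, the Poincaré dual [Hess(N,h')] of the smaller regular nilpotent Hessenberg variety inside Hess(N,h)). Then the family {P_{h'} : h' a Hessenberg function with h' ≤ h pointwise} is linearly independent over ℝ in R^{A}_{h}. -/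
open MvPolynomial

noncomputable section

/-- The variable `x_k` (1-indexed) of `ℝ[x_1,…,x_n]`. -/
def xv (n : ℕ) (k : ℕ) : MvPolynomial (Fin n) ℝ :=
  if h : 1 ≤ k ∧ k ≤ n then X ⟨k - 1, by omega⟩ else 0

/-- The polynomial `f^{A}_{i,j} = Σ_{k=1}^{i}(∏_{ℓ=i+1}^{j}(x_k−x_ℓ))·x_k`. -/
def fAij (n i j : ℕ) : MvPolynomial (Fin n) ℝ :=
  ∑ k ∈ Finset.Icc 1 i, (∏ ℓ ∈ Finset.Icc (i + 1) j, (xv n k - xv n ℓ)) * xv n k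

/-- The ideal `(f^{A}_{1,h(1)}, …, f^{A}_{n,h(n)})`,
so that `R^{A}_h = ℝ[x_1,…,x_n]/IAh n h ≅ H^*(Hess(N,h);ℝ)` in type `A_{n-1}`. -/
def IAh (n : ℕ) (h : ℕ → ℕ) : Ideal (MvPolynomial (Fin n) ℝ) :=
  Ideal.span ((fun i => fAij n i (h i)) '' Set.Icc 1 n)

/-- Hessenberg functions `h'` of type `A_{n−1}` with `h' ≤ h` pointwise (normalised by
`h' i = 0` outside `{1,…,n}`): the index set of the Poincaré duals `[Hess(N,h')]`. -/
def HessSubA (n : ℕ) (h : ℕ → ℕ) : Type :=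
  {h' : ℕ → ℕ //
    (∀ i ∈ Finset.Icc 1 n, i ≤ h' i ∧ h' i ≤ n) ∧
    (∀ i ∈ Finset.Icc 1 (n - 1), h' i ≤ h' (i + 1)) ∧
    (∀ i, i ∉ Finset.Icc 1 n → h' i = 0) ∧
    (∀ i ∈ Finset.Icc 1 n, h' i ≤ h i)}

/-- For a right exact sequence `V → W → Z → 0` of vector spaces with `V` and `Z` finite
dimensional, `dim W ≤ dim V + dim Z`, and equality forces `V → W` to be injective. -/
theorem finrank_le_add_of_rightExact {K V W Z : Type*} [Field K]
    [AddCommGroup V] [Module K V] [AddCommGroup W] [Module K W] [AddCommGroup Z] [Module K Z]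
    [FiniteDimensional K V] [FiniteDimensional K Z]
    (f : V →ₗ[K] W) (g : W →ₗ[K] Z) (hfg : LinearMap.ker g ≤ LinearMap.range f) :
    FiniteDimensional K W ∧
      Module.finrank K W ≤ Module.finrank K V + Module.finrank K Z ∧
      (Module.finrank K V + Module.finrank K Z ≤ Module.finrank K W →
        Function.Injective f) := by
  have : FiniteDimensional K (LinearMap.ker g) := Submodule.finiteDimensional_of_le hfg
  have : FiniteDimensional K W := by
    have : FiniteDimensional K (W ⧸ LinearMap.ker g) :=
      g.quotKerEquivRange.symm.finiteDimensional
    exact Module.Finite.of_submodule_quotient (LinearMap.ker g)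
  have h1 := g.finrank_range_add_finrank_ker
  have h2 := f.finrank_range_add_finrank_ker
  have h3 := Submodule.finrank_mono hfg
  have h4 := Submodule.finrank_le (LinearMap.range g)
  refine ⟨this, by omega, fun h => ?_⟩
  rw [← LinearMap.ker_eq_bot, ← Submodule.finrank_eq_zero (R := K)]
  omega

/-- Partial products `∏_{t<s} α t` filter `U / I`; the graded pieces are quotients of
`U / (I + (α s))`. If `dim U / (I + (α s)) ≤ d` for all `s < n` and `∏_{t<n} α t ∈ I`, then
`dim U / I ≤ n d`, and equality makes all these quotient maps bijective. -/
theorem finrank_quotient_le_of_filtration {K U : Type*} [Field K] [CommRing U] [Algebra K U]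
    (I : Ideal U) (α : ℕ → U) (n d : ℕ)
    (hn : ∏ t ∈ Finset.range n, α t ∈ I)
    (hfin : ∀ s < n, FiniteDimensional K (U ⧸ (I ⊔ Ideal.span {α s})))
    (hd : ∀ s < n, Module.finrank K (U ⧸ (I ⊔ Ideal.span {α s})) ≤ d) :
    FiniteDimensional K (U ⧸ I) ∧ Module.finrank K (U ⧸ I) ≤ n * d ∧
    (n * d ≤ Module.finrank K (U ⧸ I) → ∀ s < n,
      d ≤ Module.finrank K (U ⧸ (I ⊔ Ideal.span {α s})) ∧
      ∀ u, (∏ t ∈ Finset.range s, α t) * u ∈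
          I ⊔ Ideal.span {∏ t ∈ Finset.range (s + 1), α t} →
        u ∈ I ⊔ Ideal.span {α s}) := by
  set D : ℕ → U := fun s => ∏ t ∈ Finset.range s, α t with hD
  have hDs : ∀ s, D (s + 1) = D s * α s := fun s => Finset.prod_range_succ _ _
  set Q : ℕ → Ideal U := fun s => I ⊔ Ideal.span {D s} with hQ
  have hQ0 : Q 0 = ⊤ := by simp [hQ, hD]
  have hQn : Q n = I := by
    simpa [hQ, Ideal.span_le] using hn
  have hmul : ∀ s, (I ⊔ Ideal.span {α s}) ≤ Submodule.comap (LinearMap.mulLeft U (D s)) (Q (s + 1)) := by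
    intro s
    refine sup_le (fun u hu => ?_) ?_
    · exact Ideal.mem_sup_left (I.mul_mem_left _ hu)
    · rw [Ideal.span_le, Set.singleton_subset_iff]
      refine Ideal.mem_sup_right ?_
      simp [hDs]
  have hle : ∀ s, Q (s + 1) ≤ Q s := by
    intro s
    refine sup_le_sup_left ?_ _
    rw [Ideal.span_singleton_le_span_singleton, hDs]
    exact dvd_mul_right _ _
  let f : ∀ s, (U ⧸ (I ⊔ Ideal.span {α s})) →ₗ[K] (U ⧸ Q (s + 1)) := fun s =>
    (Submodule.mapQ _ _ (LinearMap.mulLeft U (D s)) (hmul s)).restrictScalars K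
  let g : ∀ s, (U ⧸ Q (s + 1)) →ₗ[K] (U ⧸ Q s) := fun s =>
    (Submodule.factor (hle s)).restrictScalars K
  have hf : ∀ s u, f s (Ideal.Quotient.mk _ u) = Ideal.Quotient.mk _ (D s * u) := fun s u => rfl
  have hg : ∀ s u, g s (Ideal.Quotient.mk _ u) = Ideal.Quotient.mk _ u := fun s u => rfl
  have hfg : ∀ s, LinearMap.ker (g s) ≤ LinearMap.range (f s) := by
    intro s w hw
    obtain ⟨u, rfl⟩ := Ideal.Quotient.mk_surjective w
    rw [LinearMap.mem_ker, hg, Ideal.Quotient.eq_zero_iff_mem] at hw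
    obtain ⟨a, ha, b, hb, rfl⟩ := Submodule.mem_sup.1 hw
    obtain ⟨v, rfl⟩ := Ideal.mem_span_singleton'.1 hb
    refine ⟨Ideal.Quotient.mk _ v, ?_⟩
    rw [hf, Ideal.Quotient.eq]
    refine Ideal.mem_sup_left ?_
    have : D s * v - (a + v * D s) = -a := by ring
    rw [this]
    exact I.neg_mem ha
  have hstep : ∀ s ≤ n, FiniteDimensional K (U ⧸ Q s) ∧ Module.finrank K (U ⧸ Q s) ≤ s * d := by
    intro s
    induction s with
    | zero =>
      intro _
      have : Subsingleton (U ⧸ Q 0) := by rw [hQ0]; exact Ideal.Quotient.subsingleton_iff.2 rfl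
      exact ⟨inferInstance, by simp [Module.finrank_zero_of_subsingleton]⟩
    | succ s ih =>
      intro hs
      obtain ⟨h1, h2⟩ := ih (by omega)
      have := hfin s (by omega)
      obtain ⟨h3, h4, -⟩ := finrank_le_add_of_rightExact (f s) (g s) (hfg s)
      have := hd s (by omega)
      refine ⟨h3, ?_⟩
      rw [add_mul, one_mul]
      omega
  have hlow : n * d ≤ Module.finrank K (U ⧸ I) → ∀ k s, s + k = n →
      s * d ≤ Module.finrank K (U ⧸ Q s) := by
    intro hnd k
    induction k with
    | zero =>
      intro s hs
      obtain rfl : s = n := by omega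
      rwa [hQn]
    | succ k ih =>
      intro s hs
      have h1 := ih (s + 1) (by omega)
      have := (hstep s (by omega)).1
      have := hfin s (by omega)
      obtain ⟨h3, h4, -⟩ := finrank_le_add_of_rightExact (f s) (g s) (hfg s)
      have := hd s (by omega)
      rw [add_mul, one_mul] at h1
      omega
  refine ⟨hQn ▸ (hstep n le_rfl).1, hQn ▸ (hstep n le_rfl).2, fun hnd s hs => ?_⟩
  have h1 := hlow hnd (n - (s + 1)) (s + 1) (by omega)
  have h2 := (hstep s (by omega)).2
  have := (hstep s (by omega)).1
  have := hfin s hs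
  obtain ⟨h3, h4, h5⟩ := finrank_le_add_of_rightExact (f s) (g s) (hfg s)
  have h6 := hd s hs
  rw [add_mul, one_mul] at h1
  refine ⟨by omega, fun u hu => ?_⟩
  have hinj := h5 (by omega)
  rw [← Ideal.Quotient.eq_zero_iff_mem] at hu ⊢
  exact hinj ((hf s u).trans (hu.trans (map_zero _).symm))

/-- Every monic polynomial of degree `n` over `A` splits into linear factors over some `A`-algebra
of dimension `n! * dim A` generated by the roots. -/
theorem exists_splitting_algebra (K : Type) [Field K] (n : ℕ) :
    ∀ (A : Type) [CommRing A] [Algebra K A] [FiniteDimensional K A] [Nontrivial A]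
      (f : Polynomial A), f.Monic → f.natDegree = n →
    ∃ (B : Type) (_ : CommRing B) (_ : Algebra K B) (φ : A →ₐ[K] B) (b : ℕ → B),
      Module.finrank K B = n.factorial * Module.finrank K A ∧
      f.map (φ : A →+* B) = ∏ k ∈ Finset.Icc 1 n, (Polynomial.X - Polynomial.C (b k)) ∧
      Algebra.adjoin K (Set.range φ ∪ b '' Set.Icc 1 n) = ⊤ := by
  induction n with
  | zero =>
    intro A _ _ _ _ f hf hn
    refine ⟨A, inferInstance, inferInstance, AlgHom.id K A, 0, by simp, ?_, ?_⟩
    · simp [hf.natDegree_eq_zero.1 hn]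
    · rw [eq_top_iff]
      exact fun x _ => Algebra.subset_adjoin (Or.inl ⟨x, rfl⟩)
  | succ n ih =>
    intro A _ _ _ _ f hf hn
    have hfin := hf.finite_adjoinRoot
    have hfree := hf.free_adjoinRoot
    have hrank : Module.finrank A (AdjoinRoot f) = n + 1 := by
      rw [(AdjoinRoot.powerBasis' hf).finrank, AdjoinRoot.powerBasis'_dim, hn]
    have : FiniteDimensional K (AdjoinRoot f) := Module.Finite.trans A _
    have hrankK : Module.finrank K (AdjoinRoot f) = Module.finrank K A * (n + 1) := by
      rw [← Module.finrank_mul_finrank K A (AdjoinRoot f), hrank]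
    have : Nontrivial (AdjoinRoot f) := by
      refine Module.nontrivial_of_finrank_pos (R := A) ?_
      omega
    set F := f.map (AdjoinRoot.of f) with hF
    have hFm : F.Monic := hf.map _
    have hFd : F.natDegree = n + 1 := by rw [hF, hf.natDegree_map, hn]
    set g := F /ₘ (Polynomial.X - Polynomial.C (AdjoinRoot.root f)) with hg
    have hFg : (Polynomial.X - Polynomial.C (AdjoinRoot.root f)) * g = F :=
      Polynomial.mul_divByMonic_eq_iff_isRoot.2 (AdjoinRoot.isRoot_root f)
    have hgm : g.Monic := (Polynomial.monic_X_sub_C _).of_mul_monic_left (hFg ▸ hFm)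
    have hgd : g.natDegree = n := by
      rw [hg, Polynomial.natDegree_divByMonic _ (Polynomial.monic_X_sub_C _), hFd,
        Polynomial.natDegree_X_sub_C]
      omega
    obtain ⟨B, _, _, φ, b, h1, h2, h3⟩ := ih (AdjoinRoot f) g hgm hgd
    let ι : A →ₐ[K] AdjoinRoot f := IsScalarTower.toAlgHom K A (AdjoinRoot f)
    refine ⟨B, inferInstance, inferInstance, φ.comp ι,
      Function.update b (n + 1) (φ (AdjoinRoot.root f)), ?_, ?_, ?_⟩
    · rw [h1, hrankK, Nat.factorial_succ]; ring
    · have : f.map ((φ.comp ι : A →ₐ[K] B) : A →+* B) = F.map (φ : AdjoinRoot f →+* B) := by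
        rw [hF, Polynomial.map_map]; rfl
      rw [this, ← hFg, Polynomial.map_mul, h2, Finset.prod_Icc_succ_top (by omega), mul_comm]
      congr 1
      · refine Finset.prod_congr rfl fun k hk => ?_
        rw [Function.update_of_ne]
        have := Finset.mem_Icc.1 hk
        omega
      · simp
    · set S := Algebra.adjoin K (Set.range (φ.comp ι) ∪
        Function.update b (n + 1) (φ (AdjoinRoot.root f)) '' Set.Icc 1 (n + 1)) with hS
      have hroot : φ (AdjoinRoot.root f) ∈ S :=
        Algebra.subset_adjoin (Or.inr ⟨n + 1, by simp, by simp⟩)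
      have hφ : ∀ p : Polynomial A, φ (AdjoinRoot.mk f p) ∈ S := by
        intro p
        induction p using Polynomial.induction_on' with
        | add p q hp hq => rw [map_add, map_add]; exact S.add_mem hp hq
        | monomial k a =>
          rw [← Polynomial.C_mul_X_pow_eq_monomial, map_mul, map_mul, map_pow, map_pow,
            AdjoinRoot.mk_X]
          exact S.mul_mem (Algebra.subset_adjoin (Or.inl ⟨a, rfl⟩)) (S.pow_mem hroot k)
      rw [eq_top_iff, ← h3]
      refine Algebra.adjoin_le ?_
      rintro _ (⟨x, rfl⟩ | ⟨k, hk, rfl⟩)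
      · obtain ⟨p, rfl⟩ := AdjoinRoot.mk_surjective x
        exact hφ p
      · refine Algebra.subset_adjoin (Or.inr ⟨k, ⟨hk.1, by have := hk.2; omega⟩, ?_⟩)
        rw [Function.update_of_ne]
        have := hk.2
        omega

/-- If `∏ (T - b k) = T ^ n`, then all power sums of positive degree of the `b k` vanish. -/
theorem sum_pow_eq_zero_of_prod_X_sub_C_eq {B : Type*} [CommRing B] (n : ℕ) (b : Fin n → B)
    (hb : ∏ k, (Polynomial.X - Polynomial.C (b k)) = Polynomial.X ^ n) (r : ℕ) (hr : 0 < r) :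
    ∑ k, b k ^ r = 0 := by
  have he : ∀ i, 0 < i → aeval b (esymm (Fin n) ℤ i) = 0 := by
    intro i hi
    rw [aeval_esymm_eq_multiset_esymm]
    by_cases hin : i ≤ n
    · have h := Multiset.prod_X_sub_C_coeff (Finset.univ.val.map b) (k := n - i) (by simp)
      rw [Multiset.map_map] at h
      change (∏ k, (Polynomial.X - Polynomial.C (b k))).coeff _ = _ at h
      rw [hb, Polynomial.coeff_X_pow, if_neg (by omega)] at h
      simp only [Multiset.card_map, Finset.card_val, Finset.card_univ, Fintype.card_fin,
        Nat.sub_sub_self hin] at h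
      have h2 : (-1 : B) ^ i * ((-1) ^ i * (Multiset.map b Finset.univ.val).esymm i) = 0 := by
        rw [← h, mul_zero]
      rwa [← mul_assoc, ← mul_pow, neg_one_mul, neg_neg, one_pow, one_mul] at h2
    · rw [Multiset.esymm, Multiset.powersetCard_eq_empty]
      · simp
      · simp; omega
  have h := congrArg (aeval b) (psum_eq_mul_esymm_sub_sum (Fin n) ℤ r hr)
  rw [psum, map_sum] at h
  simp only [map_pow, aeval_X] at h
  rw [h, map_sub, map_mul, he r hr, mul_zero, zero_sub, map_sum, neg_eq_zero]
  refine Finset.sum_eq_zero fun a ha => ?_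
  rw [map_mul, map_mul, he, mul_zero, zero_mul]
  have := (Finset.mem_filter.1 ha).2
  simp at this
  omega


/-- The ideal of `ℝ[x_0, x_1, …]` generated by the weighted power sums
`∑_{k=1}^n c_k x_k^r` with `r ≥ 1` and by the variables `x_k` with `k ∉ {1,…,n}`. -/
def weightedIdeal (n : ℕ) (c : ℕ → ℝ) : Ideal (MvPolynomial ℕ ℝ) :=
  Ideal.span (Set.range (fun r : ℕ => ∑ k ∈ Finset.Icc 1 n, C (c k) * X k ^ (r + 1)) ∪
    X '' {k | k ∉ Finset.Icc 1 n})

theorem psum_mem_weightedIdeal (n : ℕ) (c : ℕ → ℝ) (r : ℕ) :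
    ∑ k ∈ Finset.Icc 1 n, C (c k) * X k ^ (r + 1) ∈ weightedIdeal n c :=
  Ideal.subset_span (Or.inl ⟨r, rfl⟩)

theorem X_mem_weightedIdeal {n : ℕ} (c : ℕ → ℝ) {k : ℕ} (hk : k ∉ Finset.Icc 1 n) :
    X k ∈ weightedIdeal n c :=
  Ideal.subset_span (Or.inr ⟨k, hk, rfl⟩)

theorem weightedIdeal_le {n : ℕ} {c : ℕ → ℝ} {J : Ideal (MvPolynomial ℕ ℝ)}
    (h1 : ∀ r : ℕ, ∑ k ∈ Finset.Icc 1 n, C (c k) * X k ^ (r + 1) ∈ J)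
    (h2 : ∀ k ∉ Finset.Icc 1 n, X k ∈ J) : weightedIdeal n c ≤ J := by
  refine Ideal.span_le.2 ?_
  rintro _ (⟨r, rfl⟩ | ⟨k, hk, rfl⟩)
  · exact h1 r
  · exact h2 k hk

theorem sum_eval_mem_weightedIdeal (n : ℕ) (c : ℕ → ℝ) (q : Polynomial (MvPolynomial ℕ ℝ)) :
    ∑ k ∈ Finset.Icc 1 n, C (c k) * (X k * q.eval (X k)) ∈ weightedIdeal n c := by
  have : ∑ k ∈ Finset.Icc 1 n, C (c k) * (X k * q.eval (X k)) =
      ∑ r ∈ Finset.range (q.natDegree + 1),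
        q.coeff r * ∑ k ∈ Finset.Icc 1 n, C (c k) * X k ^ (r + 1) := by
    simp_rw [Polynomial.eval_eq_sum_range, Finset.mul_sum]
    rw [Finset.sum_comm]
    refine Finset.sum_congr rfl fun r _ => Finset.sum_congr rfl fun k _ => ?_
    ring
  rw [this]
  exact Ideal.sum_mem _ fun r _ => Ideal.mul_mem_left _ _ (psum_mem_weightedIdeal n c r)

/-- The value substituted for `x_{m+1}`: the variable `x_{s+1}` if `s < m`, and `0` if `s = m`. -/
def mergeTarget (m s : ℕ) : MvPolynomial ℕ ℝ := if s = m then 0 else X (s + 1)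

/-- The linear forms `x_{s+1} - x_{m+1}` for `s < m`, followed by `-x_{m+1}`. -/
def mergeForm (m s : ℕ) : MvPolynomial ℕ ℝ := mergeTarget m s - X (m + 1)

/-- The weights after the variable `x_{m+1}` is merged into `x_{s+1}`. -/
def mergeWeight (m s : ℕ) (c : ℕ → ℝ) : ℕ → ℝ :=
  Function.update c (s + 1) (c (s + 1) + c (m + 1))

/-- The substitution of `p` for `x_k`. -/
def substVar (k : ℕ) (p : MvPolynomial ℕ ℝ) : MvPolynomial ℕ ℝ →ₐ[ℝ] MvPolynomial ℕ ℝ :=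
  aeval (Function.update X k p)

theorem substVar_X_self (k : ℕ) (p : MvPolynomial ℕ ℝ) : substVar k p (X k) = p := by
  simp [substVar]

theorem substVar_X_of_ne {k j : ℕ} (p : MvPolynomial ℕ ℝ) (h : j ≠ k) :
    substVar k p (X j) = X j := by
  simp [substVar, h]

theorem substVar_mergeTarget (m s : ℕ) (p : MvPolynomial ℕ ℝ) :
    substVar (m + 1) p (mergeTarget m s) = mergeTarget m s := by
  unfold mergeTarget
  split_ifs with h
  · simp
  · exact substVar_X_of_ne _ (by omega)

theorem substVar_psum {m : ℕ} (p : MvPolynomial ℕ ℝ) (c : ℕ → ℝ) (r : ℕ) :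
    substVar (m + 1) p (∑ k ∈ Finset.Icc 1 m, C (c k) * X k ^ (r + 1)) =
      ∑ k ∈ Finset.Icc 1 m, C (c k) * X k ^ (r + 1) := by
  rw [map_sum]
  refine Finset.sum_congr rfl fun k hk => ?_
  rw [map_mul, map_pow, substVar_X_of_ne _ (by have := Finset.mem_Icc.1 hk; omega),
    ← algebraMap_eq, AlgHom.commutes]

theorem psum_mergeWeight {m s : ℕ} (hs : s ≤ m) (c : ℕ → ℝ) (r : ℕ) :
    ∑ k ∈ Finset.Icc 1 m, C (mergeWeight m s c k) * X k ^ (r + 1) =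
      ∑ k ∈ Finset.Icc 1 m, C (c k) * X k ^ (r + 1) +
        C (c (m + 1)) * mergeTarget m s ^ (r + 1) := by
  by_cases h : s = m
  · simp only [mergeTarget, if_pos h, zero_pow (Nat.succ_ne_zero r), mul_zero, add_zero]
    refine Finset.sum_congr rfl fun k hk => ?_
    rw [mergeWeight, Function.update_of_ne]
    have := Finset.mem_Icc.1 hk
    omega
  · have hmem : s + 1 ∈ Finset.Icc 1 m := Finset.mem_Icc.2 (by omega)
    rw [← Finset.add_sum_erase _ _ hmem, ← Finset.add_sum_erase _ _ hmem, mergeTarget, if_neg h]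
    have : ∑ k ∈ (Finset.Icc 1 m).erase (s + 1), C (mergeWeight m s c k) * X k ^ (r + 1) =
        ∑ k ∈ (Finset.Icc 1 m).erase (s + 1), C (c k) * (X k : MvPolynomial ℕ ℝ) ^ (r + 1) := by
      refine Finset.sum_congr rfl fun k hk => ?_
      rw [mergeWeight, Function.update_of_ne (Finset.ne_of_mem_erase hk)]
    rw [this, mergeWeight, Function.update_self, C_add]
    ring

theorem mergeWeight_pos {m : ℕ} (s : ℕ) {c : ℕ → ℝ}
    (hc : ∀ k ∈ Finset.Icc 1 (m + 1), 0 < c k) : ∀ k ∈ Finset.Icc 1 m, 0 < mergeWeight m s c k := by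
  intro k hk
  have hk' := Finset.mem_Icc.1 hk
  by_cases h : k = s + 1
  · rw [h, mergeWeight, Function.update_self]
    exact add_pos (hc _ (Finset.mem_Icc.2 (by omega))) (hc _ (Finset.mem_Icc.2 (by omega)))
  · rw [mergeWeight, Function.update_of_ne h]
    exact hc _ (Finset.mem_Icc.2 (by omega))

theorem substVar_mem_weightedIdeal {m s : ℕ} (hs : s ≤ m) (c : ℕ → ℝ) {u : MvPolynomial ℕ ℝ}
    (hu : u ∈ weightedIdeal (m + 1) c ⊔ Ideal.span {mergeForm m s}) :
    substVar (m + 1) (mergeTarget m s) u ∈ weightedIdeal m (mergeWeight m s c) := by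
  suffices h : weightedIdeal (m + 1) c ⊔ Ideal.span {mergeForm m s} ≤
      (weightedIdeal m (mergeWeight m s c)).comap (substVar (m + 1) (mergeTarget m s)) from h hu
  refine sup_le (weightedIdeal_le (fun r => ?_) fun k hk => ?_) ?_
  · rw [Ideal.mem_comap, Finset.sum_Icc_succ_top (by omega), map_add, substVar_psum, map_mul,
      map_pow, substVar_X_self, ← algebraMap_eq, AlgHom.commutes, algebraMap_eq,
      ← psum_mergeWeight hs]
    exact psum_mem_weightedIdeal _ _ _
  · rw [Finset.mem_Icc] at hk
    rw [Ideal.mem_comap, substVar_X_of_ne _ (by omega)]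
    exact X_mem_weightedIdeal _ (by rw [Finset.mem_Icc]; omega)
  · rw [Ideal.span_le, Set.singleton_subset_iff, SetLike.mem_coe, Ideal.mem_comap, mergeForm,
      map_sub, substVar_mergeTarget, substVar_X_self, sub_self]
    exact Ideal.zero_mem _

theorem finrank_quotient_sup_mergeForm_le {m s : ℕ} (hs : s ≤ m) (c : ℕ → ℝ)
    [FiniteDimensional ℝ (MvPolynomial ℕ ℝ ⧸ weightedIdeal m (mergeWeight m s c))] :
    FiniteDimensional ℝ
        (MvPolynomial ℕ ℝ ⧸ (weightedIdeal (m + 1) c ⊔ Ideal.span {mergeForm m s})) ∧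
      Module.finrank ℝ
        (MvPolynomial ℕ ℝ ⧸ (weightedIdeal (m + 1) c ⊔ Ideal.span {mergeForm m s})) ≤
      Module.finrank ℝ (MvPolynomial ℕ ℝ ⧸ weightedIdeal m (mergeWeight m s c)) := by
  set M := weightedIdeal (m + 1) c ⊔ Ideal.span {mergeForm m s} with hM
  have hform : Ideal.Quotient.mk M (mergeTarget m s) = Ideal.Quotient.mk M (X (m + 1)) :=
    Ideal.Quotient.eq.2 (Ideal.mem_sup_right (Ideal.mem_span_singleton_self _))
  have hle : weightedIdeal m (mergeWeight m s c) ≤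
      RingHom.ker ((Ideal.Quotient.mkₐ ℝ M).comp (substVar (m + 1) 0)) := by
    refine weightedIdeal_le (fun r => ?_) fun k hk => ?_
    · rw [RingHom.mem_ker, AlgHom.comp_apply, substVar_psum, psum_mergeWeight hs,
        Ideal.Quotient.mkₐ_eq_mk, map_add, map_mul, map_pow, hform, ← map_pow, ← map_mul,
        ← map_add, ← Finset.sum_Icc_succ_top (by omega), Ideal.Quotient.eq_zero_iff_mem]
      exact Ideal.mem_sup_left (psum_mem_weightedIdeal _ _ _)
    · rw [RingHom.mem_ker, AlgHom.comp_apply]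
      by_cases h : k = m + 1
      · rw [h, substVar_X_self, map_zero]
      · rw [substVar_X_of_ne _ h, Ideal.Quotient.mkₐ_eq_mk, Ideal.Quotient.eq_zero_iff_mem]
        rw [Finset.mem_Icc] at hk
        exact Ideal.mem_sup_left (X_mem_weightedIdeal _ (by rw [Finset.mem_Icc]; omega))
  let Φ := Ideal.Quotient.liftₐ (weightedIdeal m (mergeWeight m s c))
    ((Ideal.Quotient.mkₐ ℝ M).comp (substVar (m + 1) 0)) hle
  have hcomp : ((Ideal.Quotient.mkₐ ℝ M).comp (substVar (m + 1) 0)).comp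
      (substVar (m + 1) (mergeTarget m s)) = Ideal.Quotient.mkₐ ℝ M := by
    refine MvPolynomial.algHom_ext fun k => ?_
    rw [AlgHom.comp_apply, AlgHom.comp_apply]
    by_cases h : k = m + 1
    · rw [h, substVar_X_self, substVar_mergeTarget, Ideal.Quotient.mkₐ_eq_mk, hform]
    · rw [substVar_X_of_ne _ h, substVar_X_of_ne _ h]
  have hsurj : Function.Surjective Φ.toLinearMap := by
    intro w
    obtain ⟨u, rfl⟩ := Ideal.Quotient.mk_surjective w
    exact ⟨Ideal.Quotient.mk _ (substVar (m + 1) (mergeTarget m s) u),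
      DFunLike.congr_fun hcomp u⟩
  exact ⟨Module.Finite.of_surjective _ hsurj, LinearMap.finrank_le_finrank_of_surjective hsurj⟩

theorem prod_mergeForm_eq {m s : ℕ} (hs : s ≤ m) :
    ∏ t ∈ Finset.range s, mergeForm m t = ∏ t ∈ Finset.range s, (X (t + 1) - X (m + 1)) := by
  refine Finset.prod_congr rfl fun t ht => ?_
  rw [mergeForm, mergeTarget, if_neg (by have := Finset.mem_range.1 ht; omega)]

theorem prod_mergeForm_mem {m : ℕ} {c : ℕ → ℝ} (hc : c (m + 1) ≠ 0) :
    ∏ t ∈ Finset.range (m + 1), mergeForm m t ∈ weightedIdeal (m + 1) c := by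
  have h := sum_eval_mem_weightedIdeal (m + 1) c
    (∏ t ∈ Finset.range m, (Polynomial.C (X (t + 1)) - Polynomial.X))
  rw [Finset.sum_Icc_succ_top (by omega), Finset.sum_eq_zero, zero_add] at h
  · have h2 := Ideal.mul_mem_left _ (C (-(c (m + 1))⁻¹)) h
    convert h2 using 1
    rw [Finset.prod_range_succ, prod_mergeForm_eq le_rfl, mergeForm, mergeTarget, if_pos rfl,
      ← mul_assoc, ← C_mul, neg_mul, inv_mul_cancel₀ hc]
    simp only [Polynomial.eval_prod, Polynomial.eval_sub, Polynomial.eval_C, Polynomial.eval_X,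
      C_neg, C_1]
    ring
  · intro k hk
    have hk' := Finset.mem_Icc.1 hk
    rw [Polynomial.eval_prod, Finset.prod_eq_zero (i := k - 1) (Finset.mem_range.2 (by omega)),
      mul_zero, mul_zero]
    simp [Nat.sub_add_cancel hk'.1]

theorem finrank_quotient_weightedIdeal_le (n : ℕ) :
    ∀ c : ℕ → ℝ, (∀ k ∈ Finset.Icc 1 n, 0 < c k) →
      FiniteDimensional ℝ (MvPolynomial ℕ ℝ ⧸ weightedIdeal n c) ∧
      Module.finrank ℝ (MvPolynomial ℕ ℝ ⧸ weightedIdeal n c) ≤ n.factorial := by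
  induction n with
  | zero =>
    intro c _
    have hcomp : (Algebra.ofId ℝ (MvPolynomial ℕ ℝ ⧸ weightedIdeal 0 c)).comp
        (aeval (fun _ => (0 : ℝ))) = Ideal.Quotient.mkₐ ℝ (weightedIdeal 0 c) := by
      refine MvPolynomial.algHom_ext fun k => ?_
      rw [AlgHom.comp_apply, aeval_X, map_zero, Ideal.Quotient.mkₐ_eq_mk, eq_comm,
        Ideal.Quotient.eq_zero_iff_mem]
      exact X_mem_weightedIdeal _ (by simp)
    have hsurj : Function.Surjective
        (Algebra.ofId ℝ (MvPolynomial ℕ ℝ ⧸ weightedIdeal 0 c)).toLinearMap := by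
      intro w
      obtain ⟨u, rfl⟩ := Ideal.Quotient.mk_surjective w
      exact ⟨aeval (fun _ => (0 : ℝ)) u, DFunLike.congr_fun hcomp u⟩
    refine ⟨Module.Finite.of_surjective _ hsurj, ?_⟩
    simpa using LinearMap.finrank_le_finrank_of_surjective hsurj
  | succ m ih =>
    intro c hc
    have hM : ∀ s < m + 1, FiniteDimensional ℝ
          (MvPolynomial ℕ ℝ ⧸ (weightedIdeal (m + 1) c ⊔ Ideal.span {mergeForm m s})) ∧
        Module.finrank ℝ
          (MvPolynomial ℕ ℝ ⧸ (weightedIdeal (m + 1) c ⊔ Ideal.span {mergeForm m s})) ≤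
          m.factorial := by
      intro s hs
      obtain ⟨h1, h2⟩ := ih _ (mergeWeight_pos s hc)
      obtain ⟨h3, h4⟩ := finrank_quotient_sup_mergeForm_le (Nat.le_of_lt_succ hs) c
      exact ⟨h3, h4.trans h2⟩
    obtain ⟨h1, h2, -⟩ := finrank_quotient_le_of_filtration (K := ℝ) (weightedIdeal (m + 1) c)
      (mergeForm m) (m + 1) m.factorial (prod_mergeForm_mem (hc _ (by simp)).ne')
      (fun s hs => (hM s hs).1) (fun s hs => (hM s hs).2)
    exact ⟨h1, h2.trans_eq (Nat.factorial_succ m).symm⟩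

/-- Maximality of `dim ℝ[x] / I` for weights `c` is inherited by all merged weights, and the
filtration of `ℝ[x] / I` by the products of the merging forms has the largest possible pieces. -/
theorem merge_of_factorial_le_finrank {m : ℕ} {c : ℕ → ℝ}
    (hc : ∀ k ∈ Finset.Icc 1 (m + 1), 0 < c k)
    (hrank : (m + 1).factorial ≤
      Module.finrank ℝ (MvPolynomial ℕ ℝ ⧸ weightedIdeal (m + 1) c))
    {s : ℕ} (hs : s ≤ m) :
    m.factorial ≤
        Module.finrank ℝ (MvPolynomial ℕ ℝ ⧸ weightedIdeal m (mergeWeight m s c)) ∧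
      ∀ u, (∏ t ∈ Finset.range s, mergeForm m t) * u ∈
          weightedIdeal (m + 1) c ⊔ Ideal.span {∏ t ∈ Finset.range (s + 1), mergeForm m t} →
        substVar (m + 1) (mergeTarget m s) u ∈ weightedIdeal m (mergeWeight m s c) := by
  have hM : ∀ s < m + 1, FiniteDimensional ℝ
        (MvPolynomial ℕ ℝ ⧸ (weightedIdeal (m + 1) c ⊔ Ideal.span {mergeForm m s})) ∧
      Module.finrank ℝ
        (MvPolynomial ℕ ℝ ⧸ (weightedIdeal (m + 1) c ⊔ Ideal.span {mergeForm m s})) ≤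
        Module.finrank ℝ (MvPolynomial ℕ ℝ ⧸ weightedIdeal m (mergeWeight m s c)) := by
    intro s hs
    obtain ⟨h1, -⟩ := finrank_quotient_weightedIdeal_le m _
      (mergeWeight_pos s hc)
    exact finrank_quotient_sup_mergeForm_le (Nat.le_of_lt_succ hs) c
  obtain ⟨-, -, h3⟩ := finrank_quotient_le_of_filtration (K := ℝ) (weightedIdeal (m + 1) c)
    (mergeForm m) (m + 1) m.factorial (prod_mergeForm_mem (hc _ (by simp)).ne')
    (fun s hs => (hM s hs).1) (fun s hs => (hM s hs).2.trans
      (finrank_quotient_weightedIdeal_le m _ (mergeWeight_pos s hc)).2)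
  obtain ⟨h4, h5⟩ := h3 ((Nat.factorial_succ m).symm.trans_le hrank) s (Nat.lt_succ_of_le hs)
  exact ⟨h4.trans (hM s (Nat.lt_succ_of_le hs)).2,
    fun u hu => substVar_mem_weightedIdeal hs c (h5 u hu)⟩


/-- Over `ℝ`, the coinvariant algebra of the symmetric group has dimension at least `n!`. -/
theorem factorial_le_finrank_quotient_weightedIdeal (n : ℕ) :
    n.factorial ≤ Module.finrank ℝ (MvPolynomial ℕ ℝ ⧸ weightedIdeal n 1) := by
  obtain ⟨B, _, _, φ, b, hB, hprod, hgen⟩ := exists_splitting_algebra ℝ n ℝ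
    (Polynomial.X ^ n) (Polynomial.monic_X_pow n) (Polynomial.natDegree_X_pow n)
  obtain ⟨hfin, -⟩ := finrank_quotient_weightedIdeal_le n 1 (fun _ _ => one_pos)
  rw [Module.finrank_self, mul_one] at hB
  rw [Polynomial.map_pow, Polynomial.map_X] at hprod
  have hIcc : ∀ {M : Type} [CommMonoid M] (F : ℕ → M),
      ∏ k ∈ Finset.Icc 1 n, F k = ∏ k : Fin n, F (k + 1) := fun F => by
    rw [Fin.prod_univ_eq_prod_range (fun k => F (k + 1)), Finset.range_eq_Ico,
      Finset.prod_Ico_add' F 0 n 1]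
    rfl
  have hIccSum : ∀ F : ℕ → B, ∑ k ∈ Finset.Icc 1 n, F k = ∑ k : Fin n, F (k + 1) := fun F => by
    rw [Fin.sum_univ_eq_sum_range (fun k => F (k + 1)), Finset.range_eq_Ico,
      Finset.sum_Ico_add' F 0 n 1]
    rfl
  rw [hIcc] at hprod
  let θ : MvPolynomial ℕ ℝ →ₐ[ℝ] B := aeval fun k => if k ∈ Finset.Icc 1 n then b k else 0
  have hθ : ∀ k ∈ Finset.Icc 1 n, θ (X k) = b k := fun k hk => by
    simp only [θ, aeval_X, if_pos hk]
  have hle : weightedIdeal n 1 ≤ RingHom.ker θ := by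
    refine weightedIdeal_le (fun r => ?_) fun k hk => ?_
    · rw [RingHom.mem_ker, map_sum, ← sum_pow_eq_zero_of_prod_X_sub_C_eq n
        (fun k => b (k + 1)) hprod.symm (r + 1) r.succ_pos, ← hIccSum fun k => b k ^ (r + 1)]
      refine Finset.sum_congr rfl fun k hk => ?_
      rw [Pi.one_apply, C_1, one_mul, map_pow, hθ k hk]
    · simp only [RingHom.mem_ker, θ, aeval_X, if_neg hk]
  have hsurj : Function.Surjective (Ideal.Quotient.liftₐ (weightedIdeal n 1) θ hle).toLinearMap := by
    intro w
    have hw : w ∈ θ.range := by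
      suffices h : (⊤ : Subalgebra ℝ B) ≤ θ.range from h Algebra.mem_top
      rw [← hgen]
      refine Algebra.adjoin_le ?_
      rintro _ (⟨a, rfl⟩ | ⟨k, hk, rfl⟩)
      · exact ⟨C a, (θ.commutes a).trans (φ.commutes a).symm⟩
      · exact ⟨X k, hθ k (Finset.mem_Icc.2 hk)⟩
    obtain ⟨u, hu⟩ := hw
    exact ⟨Ideal.Quotient.mk _ u, hu⟩
  rw [← hB]
  exact LinearMap.finrank_le_finrank_of_surjective hsurj

/-- Hessenberg functions of type `A_{n-1}`, extended by `0` outside `{1,…,n}`. -/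
def IsHess (n : ℕ) (h : ℕ → ℕ) : Prop :=
  (∀ i ∈ Finset.Icc 1 n, i ≤ h i ∧ h i ≤ n) ∧
    (∀ i ∈ Finset.Icc 1 (n - 1), h i ≤ h (i + 1)) ∧ ∀ i, i ∉ Finset.Icc 1 n → h i = 0

/-- The product of all `x_i - x_j` with `h i < j ≤ n`. -/
def hessProd (n : ℕ) (h : ℕ → ℕ) : MvPolynomial ℕ ℝ :=
  ∏ i ∈ Finset.Icc 1 n, ∏ j ∈ Finset.Ioc (h i) n, (X i - X j)

/-- The number of initial arguments at which `h` is less than `n`. -/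
def hessDrop (n : ℕ) (h : ℕ → ℕ) : ℕ := sInf {k | n ≤ h (k + 1)}

/-- The Hessenberg function of type `A_{m-1}` obtained from one of type `A_m` by deleting the
last row and column. -/
def hessTrunc (m : ℕ) (h : ℕ → ℕ) : ℕ → ℕ := fun k => if k ∈ Finset.Icc 1 m then min (h k) m else 0

namespace IsHess

variable {m : ℕ} {h : ℕ → ℕ}

theorem apply_last (hh : IsHess (m + 1) h) : h (m + 1) = m + 1 := by
  have := hh.1 (m + 1) (by simp)
  omega

theorem drop_le (hh : IsHess (m + 1) h) : hessDrop (m + 1) h ≤ m :=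
  Nat.sInf_le hh.apply_last.ge

theorem le_of_le_drop {k : ℕ} (hk : 1 ≤ k) (hkd : k ≤ hessDrop (m + 1) h) : h k ≤ m := by
  have : k - 1 ∉ {k | m + 1 ≤ h (k + 1)} := Nat.notMem_of_lt_sInf (by
    unfold hessDrop at hkd; omega)
  rw [Set.mem_ofPred_eq, Nat.sub_add_cancel hk] at this
  omega

theorem eq_of_drop_lt (hh : IsHess (m + 1) h) {k : ℕ} (hkd : hessDrop (m + 1) h < k)
    (hk : k ≤ m + 1) : h k = m + 1 := by
  have hs : m + 1 ≤ h (hessDrop (m + 1) h + 1) :=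
    Nat.sInf_mem (s := {k | m + 1 ≤ h (k + 1)}) ⟨m, hh.apply_last.ge⟩
  have hge : m + 1 ≤ h k := by
    induction k, hkd using Nat.le_induction with
    | base => exact hs
    | succ k hk' ih =>
      exact (ih (by omega)).trans (hh.2.1 k (Finset.mem_Icc.2 (by omega)))
  have := (hh.1 k (Finset.mem_Icc.2 (by omega))).2
  omega

theorem trunc (hh : IsHess (m + 1) h) : IsHess m (hessTrunc m h) := by
  refine ⟨fun i hi => ?_, fun i hi => ?_, fun i hi => if_neg hi⟩
  · rw [hessTrunc, if_pos hi]
    have hi' := Finset.mem_Icc.1 hi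
    have := hh.1 i (Finset.mem_Icc.2 (by omega))
    omega
  · have hi' := Finset.mem_Icc.1 hi
    have := hh.2.1 i (Finset.mem_Icc.2 (by omega))
    rw [hessTrunc, hessTrunc, if_pos (Finset.mem_Icc.2 (by omega)),
      if_pos (Finset.mem_Icc.2 (by omega))]
    omega

theorem eq_of_trunc_eq {h' : ℕ → ℕ} (hh : IsHess (m + 1) h) (hh' : IsHess (m + 1) h')
    (hd : hessDrop (m + 1) h = hessDrop (m + 1) h') (ht : hessTrunc m h = hessTrunc m h') :
    h = h' := by
  funext k
  by_cases hk : k ∈ Finset.Icc 1 (m + 1)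
  · have hk' := Finset.mem_Icc.1 hk
    by_cases hkd : k ≤ hessDrop (m + 1) h
    · have hkm : k ∈ Finset.Icc 1 m := Finset.mem_Icc.2 ⟨hk'.1, hkd.trans hh.drop_le⟩
      have h1 := congrFun ht k
      rw [hessTrunc, hessTrunc, if_pos hkm, if_pos hkm] at h1
      have h2 := le_of_le_drop hk'.1 hkd
      have h3 := le_of_le_drop hk'.1 (hd ▸ hkd)
      omega
    · rw [hh.eq_of_drop_lt (by omega) hk'.2, hh'.eq_of_drop_lt (by omega) hk'.2]
  · rw [hh.2.2 k hk, hh'.2.2 k hk]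

theorem hessProd_eq (hh : IsHess (m + 1) h) :
    hessProd (m + 1) h = (∏ t ∈ Finset.range (hessDrop (m + 1) h), mergeForm m t) *
      hessProd m (hessTrunc m h) := by
  have hD : ∏ t ∈ Finset.range (hessDrop (m + 1) h), (X (t + 1) - X (m + 1)) =
      ∏ i ∈ Finset.Icc 1 m, if i ≤ hessDrop (m + 1) h then
        (X i - X (m + 1) : MvPolynomial ℕ ℝ) else 1 := by
    rw [← Finset.prod_filter, Finset.range_eq_Ico,
      Finset.prod_Ico_add' (fun t => (X t - X (m + 1) : MvPolynomial ℕ ℝ)) 0 _ 1]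
    refine Finset.prod_congr ?_ fun _ _ => rfl
    ext i
    have := hh.drop_le
    simp only [Finset.mem_Ico, Finset.mem_filter, Finset.mem_Icc]
    omega
  rw [prod_mergeForm_eq hh.drop_le, hD, hessProd, hessProd,
    Finset.prod_Icc_succ_top (by omega), hh.apply_last, Finset.Ioc_self, Finset.prod_empty,
    mul_one, ← Finset.prod_mul_distrib]
  refine Finset.prod_congr rfl fun i hi => ?_
  have hi' := Finset.mem_Icc.1 hi
  rw [hessTrunc, if_pos hi]
  split_ifs with hd
  · have := le_of_le_drop hi'.1 hd
    rw [Finset.prod_Ioc_succ_top this, min_eq_left this, mul_comm]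
  · rw [hh.eq_of_drop_lt (by omega) (by omega)]
    simp

end IsHess

/-- The classes `hessProd n h` are linearly independent modulo `weightedIdeal n c` as soon as the
quotient has the largest possible dimension. -/
theorem hessProd_linearIndependent {ι : Type} (n : ℕ) :
    ∀ c : ℕ → ℝ, (∀ k ∈ Finset.Icc 1 n, 0 < c k) →
      n.factorial ≤ Module.finrank ℝ (MvPolynomial ℕ ℝ ⧸ weightedIdeal n c) →
      ∀ (T : Finset ι) (H : ι → ℕ → ℕ), Set.InjOn H T → (∀ t ∈ T, IsHess n (H t)) →
      ∀ a : ι → ℝ, ∑ t ∈ T, C (a t) * hessProd n (H t) ∈ weightedIdeal n c →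
      ∀ t ∈ T, a t = 0 := by
  induction n with
  | zero =>
    intro c _ hrank T H hinj hH a hsum t ht
    have hT : T = {t} := by
      refine Finset.eq_singleton_iff_unique_mem.2 ⟨ht, fun t' ht' => hinj ht' ht ?_⟩
      funext k
      rw [(hH t ht).2.2 k (by simp), (hH t' ht').2.2 k (by simp)]
    rw [hT, Finset.sum_singleton, hessProd, Finset.Icc_eq_empty (by omega), Finset.prod_empty,
      mul_one] at hsum
    by_contra hne
    have htop : weightedIdeal 0 c = ⊤ :=
      Ideal.eq_top_of_isUnit_mem _ hsum ((Ne.isUnit hne).map C)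
    have : Subsingleton (MvPolynomial ℕ ℝ ⧸ weightedIdeal 0 c) :=
      Ideal.Quotient.subsingleton_iff.2 htop
    rw [Module.finrank_zero_of_subsingleton] at hrank
    simp at hrank
  | succ m ih =>
    intro c hc hrank T H hinj hH a hsum
    suffices hdrop : ∀ s, ∀ t ∈ T, hessDrop (m + 1) (H t) = s → a t = 0 from
      fun t ht => hdrop _ t ht rfl
    intro s
    induction s using Nat.strong_induction_on with
    | _ s ihs =>
    intro t₀ ht₀ hst₀
    have hs : s ≤ m := hst₀ ▸ (hH t₀ ht₀).drop_le
    obtain ⟨hrank', hker⟩ := merge_of_factorial_le_finrank hc hrank hs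
    set Ts := T.filter fun t => hessDrop (m + 1) (H t) = s with hTs
    have hmem : ∀ t ∈ Ts, t ∈ T ∧ hessDrop (m + 1) (H t) = s := fun t ht => Finset.mem_filter.1 ht
    have hlead : (∏ t ∈ Finset.range s, mergeForm m t) *
        (∑ t ∈ Ts, C (a t) * hessProd m (hessTrunc m (H t))) ∈
        weightedIdeal (m + 1) c ⊔ Ideal.span {∏ t ∈ Finset.range (s + 1), mergeForm m t} := by
      have hsplit := Finset.sum_filter_add_sum_filter_not T
        (fun t => hessDrop (m + 1) (H t) = s) fun t => C (a t) * hessProd (m + 1) (H t)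
      have heq : (∏ t ∈ Finset.range s, mergeForm m t) *
          (∑ t ∈ Ts, C (a t) * hessProd m (hessTrunc m (H t))) =
          ∑ t ∈ Ts, C (a t) * hessProd (m + 1) (H t) := by
        rw [Finset.mul_sum]
        refine Finset.sum_congr rfl fun t ht => ?_
        rw [(hH t (hmem t ht).1).hessProd_eq, (hmem t ht).2]
        ring
      rw [heq, eq_sub_of_add_eq hsplit]
      refine Ideal.sub_mem _ (Ideal.mem_sup_left hsum)
        (Ideal.mem_sup_right (Ideal.sum_mem _ fun t ht => ?_))
      obtain ⟨htT, hts⟩ := Finset.mem_filter.1 ht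
      rcases lt_or_gt_of_ne hts with hlt | hgt
      · rw [ihs _ hlt t htT rfl, C_0, zero_mul]
        exact Ideal.zero_mem _
      · rw [Ideal.mem_span_singleton, (hH t htT).hessProd_eq]
        exact Dvd.dvd.mul_left (Dvd.dvd.mul_right
          (Finset.prod_dvd_prod_of_subset _ _ _ (Finset.range_mono hgt)) _) _
    have hsub := hker _ hlead
    have hfix : ∀ h : ℕ → ℕ, substVar (m + 1) (mergeTarget m s) (hessProd m h) = hessProd m h := by
      intro h
      rw [hessProd, map_prod]
      refine Finset.prod_congr rfl fun i hi => ?_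
      rw [map_prod]
      refine Finset.prod_congr rfl fun j hj => ?_
      have hi' := Finset.mem_Icc.1 hi
      have hj' := Finset.mem_Ioc.1 hj
      rw [map_sub, substVar_X_of_ne _ (by omega), substVar_X_of_ne _ (by omega)]
    rw [map_sum] at hsub
    simp only [map_mul, hfix, ← algebraMap_eq, AlgHom.commutes] at hsub
    rw [algebraMap_eq] at hsub
    refine ih _ (mergeWeight_pos s hc) hrank' Ts (fun t => hessTrunc m (H t)) ?_
      (fun t ht => (hH t (hmem t ht).1).trunc) a hsub t₀ (Finset.mem_filter.2 ⟨ht₀, hst₀⟩)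
    intro t ht t' ht' heq
    obtain ⟨h1, h2⟩ := hmem t ht
    obtain ⟨h3, h4⟩ := hmem t' ht'
    exact hinj h1 h3 ((hH t h1).eq_of_trunc_eq (hH t' h3) (h2.trans h4.symm) heq)

/-- The polynomial `f^A_{i,j}` in the polynomial ring with variables indexed by `ℕ`. -/
def hessRel (i j : ℕ) : MvPolynomial ℕ ℝ :=
  ∑ k ∈ Finset.Icc 1 i, (∏ l ∈ Finset.Ioc i j, (X k - X l)) * X k

theorem hessRel_eq_sum {i N : ℕ} (hiN : i ≤ N) {j : ℕ} (hNj : N ≤ j) :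
    hessRel i j = ∑ k ∈ Finset.Icc 1 N, (∏ l ∈ Finset.Ioc i j, (X k - X l)) * X k := by
  refine Finset.sum_subset (Finset.Icc_subset_Icc_right hiN) fun k hk hki => ?_
  rw [Finset.mem_Icc] at hk hki
  rw [Finset.prod_eq_zero (Finset.mem_Ioc.2 (by omega : i < k ∧ k ≤ j)) (sub_self _), zero_mul]

theorem hessRel_mem_weightedIdeal {i n : ℕ} (hi : i ≤ n) : hessRel i n ∈ weightedIdeal n 1 := by
  rw [hessRel_eq_sum hi le_rfl]
  convert sum_eval_mem_weightedIdeal n 1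
    (∏ l ∈ Finset.Ioc i n, (Polynomial.X - Polynomial.C (X l))) using 2 with k
  simp [Polynomial.eval_prod, mul_comm]

theorem prod_Ioc_eq_mul_prod {M : Type*} [CommMonoid M] (F : ℕ → M) {a b : ℕ} (hab : a < b) :
    ∏ l ∈ Finset.Ioc a b, F l = F (a + 1) * ∏ l ∈ Finset.Ioc (a + 1) b, F l := by
  rw [← Finset.prod_Ioc_consecutive F (Nat.le_succ a) hab, Nat.Ioc_succ_singleton,
    Finset.prod_singleton]

theorem hessRel_succ_succ {i m : ℕ} (him : i < m) :
    hessRel (i + 1) (m + 1) =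
      hessRel i m + (X (i + 1) - X (m + 1)) * hessRel (i + 1) m := by
  rw [hessRel_eq_sum (Nat.le_succ i) him, hessRel, hessRel, Finset.mul_sum,
    ← Finset.sum_add_distrib]
  refine Finset.sum_congr rfl fun k _ => ?_
  rw [Finset.prod_Ioc_succ_top him, prod_Ioc_eq_mul_prod _ him]
  ring

theorem hessRel_mul_mem_weightedIdeal {n : ℕ} {h : ℕ → ℕ}
    (hh1 : ∀ i ∈ Finset.Icc 1 n, i ≤ h i) (hh2 : ∀ i ∈ Finset.Icc 1 (n - 1), h i ≤ h (i + 1))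
    (i : ℕ) : i + 1 ≤ n → ∀ d m, m + d = n → h (i + 1) ≤ m →
      hessRel (i + 1) m * (∏ k ∈ Finset.Icc 1 i, ∏ j ∈ Finset.Ioc (h k) n, (X k - X j)) *
        ∏ j ∈ Finset.Ioc m n, (X (i + 1) - X j) ∈ weightedIdeal n 1 := by
  induction i with
  | zero =>
    intro hi d
    induction d with
    | zero =>
      rintro m rfl -
      exact Ideal.mul_mem_right _ _ (Ideal.mul_mem_right _ _ (hessRel_mem_weightedIdeal hi))
    | succ d ihd =>
      intro m hm hhm
      have := hh1 (0 + 1) (Finset.mem_Icc.2 (by omega))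
      have h1 := ihd (m + 1) (by omega) (by omega)
      have h0 : hessRel 0 m = 0 := Finset.sum_empty
      rw [hessRel_succ_succ (by omega), h0] at h1
      rw [prod_Ioc_eq_mul_prod _ (by omega)]
      convert h1 using 1
      ring
  | succ i ih =>
    intro hi d
    induction d with
    | zero =>
      rintro m rfl -
      exact Ideal.mul_mem_right _ _ (Ideal.mul_mem_right _ _ (hessRel_mem_weightedIdeal hi))
    | succ d ihd =>
      intro m hm hhm
      have hle := hh1 (i + 1 + 1) (Finset.mem_Icc.2 (by omega))
      have hmono := hh2 (i + 1) (Finset.mem_Icc.2 (by omega))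
      have h1 := ihd (m + 1) (by omega) (by omega)
      have h2 := Ideal.mul_mem_left _ ((∏ j ∈ Finset.Ioc (h (i + 1)) m, (X (i + 1) - X j)) *
        ∏ j ∈ Finset.Ioc (m + 1) n, (X (i + 1 + 1) - X j))
        (ih (by omega) (d + 1) m hm (by omega))
      have h3 := Ideal.sub_mem _ h1 h2
      convert h3 using 1
      rw [hessRel_succ_succ (by omega), prod_Ioc_eq_mul_prod _ (by omega : m < n),
        Finset.prod_Icc_succ_top (by omega),
        ← Finset.prod_Ioc_consecutive _ (by omega : h (i + 1) ≤ m) (by omega : m ≤ n)]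
      ring

theorem hessProd_mul_hessRel_mem {n : ℕ} {h : ℕ → ℕ}
    (hh1 : ∀ i ∈ Finset.Icc 1 n, i ≤ h i ∧ h i ≤ n)
    (hh2 : ∀ i ∈ Finset.Icc 1 (n - 1), h i ≤ h (i + 1)) {i : ℕ} (hi : i ∈ Finset.Icc 1 n) :
    hessProd n h * hessRel i (h i) ∈ weightedIdeal n 1 := by
  have hi' := Finset.mem_Icc.1 hi
  obtain ⟨i, rfl⟩ : ∃ k, i = k + 1 := ⟨i - 1, by omega⟩
  have h1 := hessRel_mul_mem_weightedIdeal (fun i hi => (hh1 i hi).1) hh2 i hi'.2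
    (n - h (i + 1)) (h (i + 1)) (by have := hh1 _ hi; omega) le_rfl
  rw [mul_assoc, ← Finset.prod_Icc_succ_top (by omega)
    (fun k => ∏ j ∈ Finset.Ioc (h k) n, (X k - X j : MvPolynomial ℕ ℝ)), mul_comm] at h1
  refine Ideal.mem_of_dvd _ (mul_dvd_mul_right ?_ _) h1
  exact Finset.prod_dvd_prod_of_subset _ _ _ (Finset.Icc_subset_Icc_right hi'.2)

/-- The inclusion `ℝ[x_1,…,x_n] ⊆ ℝ[x_0,x_1,…]`. -/
def embedVars (n : ℕ) : MvPolynomial (Fin n) ℝ →ₐ[ℝ] MvPolynomial ℕ ℝ :=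
  rename fun j => (j : ℕ) + 1

theorem embedVars_xv {n k : ℕ} (hk : 1 ≤ k ∧ k ≤ n) : embedVars n (xv n k) = X k := by
  rw [xv, dif_pos hk, embedVars, rename_X, Nat.sub_add_cancel hk.1]

theorem hessProd_mul_embedVars_mem {n : ℕ} {h : ℕ → ℕ}
    (hh1 : ∀ i ∈ Finset.Icc 1 n, i ≤ h i ∧ h i ≤ n)
    (hh2 : ∀ i ∈ Finset.Icc 1 (n - 1), h i ≤ h (i + 1)) {u : MvPolynomial (Fin n) ℝ}
    (hu : u ∈ IAh n h) : hessProd n h * embedVars n u ∈ weightedIdeal n 1 := by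
  refine Submodule.span_induction (fun x hx => ?_) ?_ (fun x y _ _ hx hy => ?_)
    (fun a x _ hx => ?_) hu
  · obtain ⟨i, hi, rfl⟩ := hx
    have hin := hh1 i (Finset.mem_Icc.2 hi)
    have : embedVars n (fAij n i (h i)) = hessRel i (h i) := by
      rw [fAij, hessRel, map_sum, Finset.Icc_add_one_left_eq_Ioc]
      refine Finset.sum_congr rfl fun k hk => ?_
      have hk' := Finset.mem_Icc.1 hk
      rw [map_mul, map_prod, embedVars_xv ⟨hk'.1, hk'.2.trans hi.2⟩]
      congr 1
      refine Finset.prod_congr rfl fun l hl => ?_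
      have hl' := Finset.mem_Ioc.1 hl
      rw [map_sub, embedVars_xv ⟨hk'.1, hk'.2.trans hi.2⟩, embedVars_xv (by omega)]
    rw [this]
    exact hessProd_mul_hessRel_mem hh1 hh2 (Finset.mem_Icc.2 hi)
  · rw [map_zero, mul_zero]
    exact Ideal.zero_mem _
  · rw [map_add, mul_add]
    exact Ideal.add_mem _ hx hy
  · rw [smul_eq_mul, map_mul, mul_left_comm]
    exact Ideal.mul_mem_left _ _ hx

theorem hessProd_mul_embedVars_prod {n : ℕ} {h h' : ℕ → ℕ}
    (hh : ∀ i ∈ Finset.Icc 1 n, h i ≤ n) (hle : ∀ i ∈ Finset.Icc 1 n, h' i ≤ h i) :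
    hessProd n h * embedVars n (∏ i ∈ Finset.Icc 1 n, ∏ j ∈ Finset.Icc (h' i + 1) (h i),
      (xv n i - xv n j)) = hessProd n h' := by
  rw [hessProd, hessProd, map_prod, ← Finset.prod_mul_distrib]
  refine Finset.prod_congr rfl fun i hi => ?_
  rw [← Finset.prod_Ioc_consecutive _ (hle i hi) (hh i hi), map_prod, mul_comm,
    Finset.Icc_add_one_left_eq_Ioc]
  congr 1
  refine Finset.prod_congr rfl fun j hj => ?_
  have hj' := Finset.mem_Ioc.1 hj
  have hhi := hh i hi
  rw [map_sub, embedVars_xv (Finset.mem_Icc.1 hi), embedVars_xv (by omega)]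

/-- **Theorem 7.1 (type A).** For a Hessenberg function `h` of type `A_{n−1}`, the classes
`P_{h'} = ∏_{i} ∏_{j=h'(i)+1}^{h(i)} (x_i − x_j)` in `R^{A}_h ≅ H^*(Hess(N,h))` — which
are, up to nonzero scalars, the Poincaré duals `[Hess(N,h')]` of the smaller regular
nilpotent Hessenberg varieties — are linearly independent over ℝ. -/
theorem stmt_15 (n : ℕ) (hn : 1 ≤ n) (h : ℕ → ℕ)
    (hh1 : ∀ i ∈ Finset.Icc 1 n, i ≤ h i ∧ h i ≤ n)
    (hh2 : ∀ i ∈ Finset.Icc 1 (n - 1), h i ≤ h (i + 1)) :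
    LinearIndependent ℝ (fun h' : HessSubA n h =>
      Ideal.Quotient.mk (IAh n h)
        (∏ i ∈ Finset.Icc 1 n, ∏ j ∈ Finset.Icc (h'.1 i + 1) (h i),
          (xv n i - xv n j))) := by
  rw [linearIndependent_iff']
  intro T a hsum
  refine hessProd_linearIndependent n 1 (fun _ _ => one_pos)
    (factorial_le_finrank_quotient_weightedIdeal n) T (fun h' => h'.1)
    (fun _ _ _ _ heq => Subtype.ext heq)
    (fun h' _ => ⟨h'.2.1, h'.2.2.1, h'.2.2.2.1⟩) a ?_
  have hmem : ∑ h' ∈ T, C (a h') * (∏ i ∈ Finset.Icc 1 n,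
      ∏ j ∈ Finset.Icc (h'.1 i + 1) (h i), (xv n i - xv n j)) ∈ IAh n h := by
    rw [← Ideal.Quotient.eq_zero_iff_mem, ← hsum, map_sum]
    refine Finset.sum_congr rfl fun h' _ => ?_
    rw [C_mul', ← Ideal.Quotient.mkₐ_eq_mk ℝ, map_smul]
  convert hessProd_mul_embedVars_mem hh1 hh2 hmem using 1
  rw [map_sum, Finset.mul_sum]
  refine Finset.sum_congr rfl fun h' _ => ?_
  rw [map_mul, mul_left_comm, hessProd_mul_embedVars_prod (fun i hi => (hh1 i hi).2) h'.2.2.2.2,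
    algHom_C, algebraMap_eq]
end
end

section
/- Let h be a Hessenberg function for type B_n. For each Hessenberg function h' for type B_n with h'(i) ≤ h(i) for all i, let P_{h'} denote the class of ∏_{i=1}^{n} ∏_{j=h'(i)+1}^{h(i)} α^{B}_{i,j} in R^{B}_{h} (this class equals, up to a nonzero scalar, the Poincaré dual [Hess(N,h')] of the smaller regular nilpotent Hessenberg variety inside Hess(N,h)). Then the family {P_{h'} : h' a Hessenberg function with h' ≤ h pointwise} is linearly independent over ℝ in R^{B}_{h}. -/
open MvPolynomial

noncomputable section

/-- The type `B_n` root label `α^{B}_{i,j}`: `x_i − x_j` for `i+1 ≤ j ≤ n`, `x_i` for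
`j = n+1`, and `x_i + x_{2n+2−j}` for `n+2 ≤ j ≤ 2n+1−i`. -/
def alB (n i j : ℕ) : MvPolynomial (Fin n) ℝ :=
  if j ≤ n then xv n i - xv n j
  else if j = n + 1 then xv n i
  else xv n i + xv n (2 * n + 2 - j)

/-- The polynomial `f^{B}_{i,j} = Σ_{k=1}^{i}(∏_{ℓ=i+1}^{j} α^{B}_{k,ℓ})·x_k`. -/
def fBij (n i j : ℕ) : MvPolynomial (Fin n) ℝ :=
  ∑ k ∈ Finset.Icc 1 i, (∏ ℓ ∈ Finset.Icc (i + 1) j, alB n k ℓ) * xv n k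

/-- The ideal `(f^{B}_{1,h(1)}, …, f^{B}_{n,h(n)})`,
so that `R^{B}_h = ℝ[x_1,…,x_n]/IBh n h ≅ H^*(Hess(N,h);ℝ)` in type `B_n`. -/
def IBh (n : ℕ) (h : ℕ → ℕ) : Ideal (MvPolynomial (Fin n) ℝ) :=
  Ideal.span ((fun i => fBij n i (h i)) '' Set.Icc 1 n)

/-- Hessenberg functions `h'` of type `B_n` with `h' ≤ h` pointwise (normalised by
`h' i = 0` outside `{1,…,n}`): the index set of the Poincaré duals `[Hess(N,h')]`. -/
def HessSubB (n : ℕ) (h : ℕ → ℕ) : Type :=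
  {h' : ℕ → ℕ //
    (∀ i ∈ Finset.Icc 1 n, i ≤ h' i ∧ h' i ≤ 2 * n + 1 - i) ∧
    (∀ i ∈ Finset.Icc 1 (n - 1), h' i ≠ 2 * n + 1 - i → h' i ≤ h' (i + 1)) ∧
    (∀ i ∈ Finset.Icc 1 (n - 1), h' i = 2 * n + 1 - i → h' (i + 1) = 2 * n + 1 - (i + 1)) ∧
    (∀ i, i ∉ Finset.Icc 1 n → h' i = 0) ∧
    (∀ i ∈ Finset.Icc 1 n, h' i ≤ h i)}

open RingTheory.Sequence IsLocalRing
open scoped Pointwise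

section RegularSequences

variable {R : Type*} [CommRing R]

lemma isWeaklyRegular_concat_iff (rs : List R) (a : R) :
    IsWeaklyRegular R (rs ++ [a]) ↔
      IsWeaklyRegular R rs ∧ ∀ y, a * y ∈ Ideal.ofList rs → y ∈ Ideal.ofList rs := by
  rw [isWeaklyRegular_append_iff, isWeaklyRegular_singleton_iff]
  refine and_congr_right fun _ => ?_
  rw [isSMulRegular_iff_right_eq_zero_of_smul]
  have key : ∀ z : R, (Submodule.Quotient.mk z :
      R ⧸ (Ideal.ofList rs • ⊤ : Submodule R R)) = 0 ↔ z ∈ Ideal.ofList rs := fun z => by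
    rw [Submodule.Quotient.mk_eq_zero, smul_eq_mul, Ideal.mul_top]
  constructor
  · intro H y hy
    rw [← key] at hy ⊢
    exact H _ hy
  · intro H y hy
    obtain ⟨y, rfl⟩ := Submodule.Quotient.mk_surjective _ y
    rw [← Submodule.Quotient.mk_smul, key] at hy
    exact (key y).2 (H y hy)

lemma isWeaklyRegular_cons_iff_quotient (r : R) (rs : List R) :
    IsWeaklyRegular R (r :: rs) ↔ IsSMulRegular R r ∧
      IsWeaklyRegular (R ⧸ Ideal.span {r}) (rs.map (Ideal.Quotient.mk (Ideal.span {r}))) := by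
  rw [isWeaklyRegular_cons_iff]
  refine and_congr_right fun _ => ?_
  have e : (r • ⊤ : Submodule R R) = Ideal.span {r} := by
    rw [← Submodule.ideal_span_singleton_smul, smul_eq_mul, Ideal.mul_top]
  refine AddEquiv.isWeaklyRegular_congr
    (e := (Submodule.quotEquivOfEq (r • ⊤) (Ideal.span {r}) e).toAddEquiv) ?_
  rw [List.forall₂_map_right_iff, List.forall₂_same]
  intro a _ y
  obtain ⟨y, rfl⟩ := Submodule.Quotient.mk_surjective _ y
  rfl

variable [IsLocalRing R] [IsNoetherianRing R]

lemma isWeaklyRegular_cons_iff_of_mem_maximalIdeal {a : R} {rs : List R}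
    (ha : a ∈ maximalIdeal R) (hrs : ∀ r ∈ rs, r ∈ maximalIdeal R) :
    IsWeaklyRegular R (a :: rs) ↔
      IsWeaklyRegular R rs ∧ ∀ y, a * y ∈ Ideal.ofList rs → y ∈ Ideal.ofList rs := by
  rw [← isWeaklyRegular_concat_iff]
  have hp : (a :: rs).Perm (rs ++ [a]) := (List.perm_append_singleton a rs).symm
  have hmem : ∀ r ∈ a :: rs, r ∈ maximalIdeal R := by simpa using ⟨ha, hrs⟩
  exact ⟨fun H => isWeaklyRegular_of_perm_of_subset_maximalIdeal H hp hmem,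
    fun H => isWeaklyRegular_of_perm_of_subset_maximalIdeal H hp.symm
      fun r hr => hmem r (hp.symm.subset hr)⟩

lemma IsWeaklyRegular.cons_congr {a b : R} {rs : List R} (H : IsWeaklyRegular R (a :: rs))
    (ha : a ∈ maximalIdeal R) (hb : b ∈ maximalIdeal R) (hrs : ∀ r ∈ rs, r ∈ maximalIdeal R)
    (hab : a - b ∈ Ideal.ofList rs) : IsWeaklyRegular R (b :: rs) := by
  rw [isWeaklyRegular_cons_iff_of_mem_maximalIdeal ha hrs] at H
  rw [isWeaklyRegular_cons_iff_of_mem_maximalIdeal hb hrs]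
  refine ⟨H.1, fun y hy => H.2 y ?_⟩
  have : a * y = (a - b) * y + b * y := by ring
  rw [this]
  exact add_mem (Ideal.mul_mem_right _ _ hab) hy

end RegularSequences

lemma isLocalRing_quotient_span {R : Type*} [CommRing R] [IsLocalRing R] {a : R}
    (ha : a ∈ maximalIdeal R) : IsLocalRing (R ⧸ Ideal.span {a}) := by
  have : Nontrivial (R ⧸ Ideal.span {a}) := by
    rw [Ideal.Quotient.nontrivial_iff]
    intro e
    exact (Ideal.ne_top_iff_one _).1 (maximalIdeal.isMaximal R).ne_top
      ((Ideal.span_singleton_le_iff_mem _).2 ha (e ▸ Submodule.mem_top))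
  exact IsLocalRing.of_surjective' (Ideal.Quotient.mk _) Ideal.Quotient.mk_surjective

lemma mk_mem_maximalIdeal {R : Type*} [CommRing R] [IsLocalRing R] (I : Ideal R)
    [IsLocalRing (R ⧸ I)] {b : R} (hb : b ∈ maximalIdeal R) :
    Ideal.Quotient.mk I b ∈ maximalIdeal (R ⧸ I) := by
  have hloc : IsLocalHom (Ideal.Quotient.mk I) :=
    IsLocalHom.of_surjective _ Ideal.Quotient.mk_surjective
  exact map_nonunit (Ideal.Quotient.mk I) b hb

section Generators

variable {R S : Type*} [CommRing R] [CommRing S]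

/-- The root label `α^B_{i,j}` evaluated at elements `x_1, …, x_n` of a ring. -/
def rootB (n : ℕ) (x : ℕ → R) (i j : ℕ) : R :=
  if j ≤ n then x i - x j else if j = n + 1 then x i else x i + x (2 * n + 2 - j)

/-- The product of all labels `α^B_{k,l}` with `i < l ≤ 2n + 1 - i`, times `x_k`, is even in
`x_k`. -/
lemma prod_rootB_mul_of_neg {n i s m : ℕ} (x : ℕ → R) (hi : i ≤ n) (hx : x s = -x m) :
    (∏ l ∈ Finset.Icc (i + 1) (2 * n + 1 - i), rootB n x s l) * x s =
      (∏ l ∈ Finset.Icc (i + 1) (2 * n + 1 - i), rootB n x m l) * x m := by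
  have h1 : ∏ l ∈ Finset.Icc (i + 1) (2 * n + 1 - i), rootB n x s l =
      ∏ l ∈ Finset.Icc (i + 1) (2 * n + 1 - i), -rootB n x m l := by
    refine Finset.prod_nbij' (fun l => 2 * n + 2 - l) (fun l => 2 * n + 2 - l) ?_ ?_ ?_ ?_ ?_
    · intro l hl; rw [Finset.mem_Icc] at hl ⊢; omega
    · intro l hl; rw [Finset.mem_Icc] at hl ⊢; omega
    · intro l hl; rw [Finset.mem_Icc] at hl; omega
    · intro l hl; rw [Finset.mem_Icc] at hl; omega
    · intro l hl
      rw [Finset.mem_Icc] at hl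
      unfold rootB
      rcases lt_trichotomy l (n + 1) with h | h | h
      · rw [if_pos (by omega), if_neg (by omega), if_neg (by omega), hx,
          show 2 * n + 2 - (2 * n + 2 - l) = l by omega]
        ring
      · rw [if_neg (by omega), if_pos h, if_neg (by omega), if_pos (by omega), hx]
      · rw [if_neg (by omega), if_neg (by omega), if_pos (by omega), hx]
        ring
  have hodd : Odd (2 * n + 1 - i + 1 - (i + 1)) := ⟨n - i, by omega⟩
  rw [h1, Finset.prod_neg, Nat.card_Icc, hodd.neg_one_pow, hx]
  ring

/-- The linear factors of `f^B_{s,j}`: `x_s` for `M = s` and `α^B_{s,M}` for `M > s`. -/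
def linB (n : ℕ) (x : ℕ → R) (s M : ℕ) : R :=
  if M = s then x s else rootB n x s M

lemma linB_mem {I : Ideal R} {n : ℕ} {x : ℕ → R} {s M : ℕ} (hsn : s ≤ n)
    (hx : ∀ k, s ≤ k → k ≤ n → x k ∈ I) (hsM : s ≤ M) (hM : M ≤ 2 * n + 1 - s) :
    linB n x s M ∈ I := by
  have h0 := hx s le_rfl hsn
  unfold linB rootB
  split_ifs
  · exact h0
  · exact sub_mem h0 (hx _ hsM (by omega))
  · exact h0
  · exact add_mem h0 (hx _ (by omega) (by omega))

lemma sub_linB_mem {n : ℕ} (x : ℕ → R) {s M d : ℕ} (hd : s + d = n) (hsM : s ≤ M)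
    (hM : M ≤ 2 * n + 1 - s) : x s - linB n x s M ∈
      Ideal.ofList ((List.range' (s + 1) d).map x) := by
  have key : ∀ k, s < k → k ≤ n → x k ∈ Ideal.ofList ((List.range' (s + 1) d).map x) :=
    fun k h1 h2 => Ideal.subset_span
      (List.mem_map.2 ⟨k, List.mem_range'_1.2 (by omega), rfl⟩)
  unfold linB rootB
  split_ifs
  · simp
  · simpa using key M (by omega) (by omega)
  · simp
  · simpa using key (2 * n + 2 - M) (by omega) (by omega)

variable [Algebra ℝ R] [Algebra ℝ S]

/-- The polynomial `f^B_{i,j}` in the variables `x_s, …, x_n` alone, with the `k`-th summand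
scaled by the weight `c k`. -/
def genB (n : ℕ) (x : ℕ → R) (c : ℕ → ℝ) (s i j : ℕ) : R :=
  ∑ k ∈ Finset.Icc s i, c k • ((∏ l ∈ Finset.Icc (i + 1) j, rootB n x k l) * x k)

lemma map_rootB (φ : R →ₐ[ℝ] S) (n : ℕ) (x : ℕ → R) (i j : ℕ) :
    φ (rootB n x i j) = rootB n (fun k => φ (x k)) i j := by
  simp only [rootB, apply_ite φ, map_sub, map_add]

lemma map_genB (φ : R →ₐ[ℝ] S) (n : ℕ) (x : ℕ → R) (c : ℕ → ℝ) (s i j : ℕ) :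
    φ (genB n x c s i j) = genB n (fun k => φ (x k)) c s i j := by
  simp only [genB, map_sum, map_smul, map_mul, map_prod, map_rootB]

lemma map_linB (φ : R →ₐ[ℝ] S) (n : ℕ) (x : ℕ → R) (s M : ℕ) :
    φ (linB n x s M) = linB n (fun k => φ (x k)) s M := by
  simp only [linB, apply_ite φ, map_rootB]

lemma genB_self (n : ℕ) (x : ℕ → R) (c : ℕ → ℝ) {s j : ℕ} (hsj : s ≤ j) :
    genB n x c s s j = c s • ∏ M ∈ Finset.Icc s j, linB n x s M := by
  rw [← Finset.insert_Icc_add_one_left_eq_Icc hsj, Finset.prod_insert (by simp)]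
  simp only [genB, Finset.Icc_self, Finset.sum_singleton]
  rw [mul_comm]
  congr 2
  · simp [linB]
  · refine Finset.prod_congr rfl fun l hl => ?_
    rw [Finset.mem_Icc] at hl
    rw [linB, if_neg (by omega)]

/-- Conditions on a Hessenberg function used below: bounds, and monotonicity away from the
maximal values. -/
structure IsHessB (n : ℕ) (h : ℕ → ℕ) : Prop where
  le_apply : ∀ i, 1 ≤ i → i ≤ n → i ≤ h i
  apply_le : ∀ i, 1 ≤ i → i ≤ n → h i ≤ 2 * n + 1 - i
  mono : ∀ s i, 1 ≤ s → s ≤ i → i ≤ n → h i = 2 * n + 1 - i ∨ h s ≤ h i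

lemma genB_eq_add_single (n : ℕ) (x : ℕ → R) (c : ℕ → ℝ) (s i j m : ℕ) (b : ℝ) :
    genB n x (fun k => c k + if k = m then b else 0) s i j = genB n x c s i j +
      if m ∈ Finset.Icc s i then
        b • ((∏ l ∈ Finset.Icc (i + 1) j, rootB n x m l) * x m) else 0 := by
  simp only [genB, add_smul, ite_smul, zero_smul, Finset.sum_add_distrib, Finset.sum_ite_eq']

/-- If a linear factor of `f^B_{s,h(s)}` vanishes, the remaining generators become generators in
the variables `x_{s+1}, …, x_n`, with new positive weights. -/
lemma exists_genB_eq_of_linB_eq_zero {n : ℕ} {h : ℕ → ℕ} (hh : IsHessB n h) (x : ℕ → R)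
    {c : ℕ → ℝ} (hc : ∀ k, 0 < c k) {s M : ℕ} (hs : 1 ≤ s) (hsn : s ≤ n) (hsM : s ≤ M)
    (hM : M ≤ h s) (hL : linB n x s M = 0) :
    ∃ c' : ℕ → ℝ, (∀ k, 0 < c' k) ∧
      ∀ i, s < i → i ≤ n → genB n x c s i (h i) = genB n x c' (s + 1) i (h i) := by
  have hsplit : ∀ i, s < i → genB n x c s i (h i) =
      c s • ((∏ l ∈ Finset.Icc (i + 1) (h i), rootB n x s l) * x s) +
        genB n x c (s + 1) i (h i) := fun i hi => by
    rw [genB, ← Finset.insert_Icc_add_one_left_eq_Icc hi.le, Finset.sum_insert (by simp)]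
    rfl
  have hmax := hh.apply_le s hs hsn
  by_cases h0 : x s = 0
  · exact ⟨c, hc, fun i hi _ => by rw [hsplit i hi, h0, mul_zero, smul_zero, zero_add]⟩
  have hMs : M ≠ s := fun e => h0 (by simpa [linB, e] using hL)
  have hMn : M ≠ n + 1 := fun e => h0 (by
    rw [linB, if_neg hMs, rootB, if_neg (by omega), if_pos e] at hL
    exact hL)
  rw [linB, if_neg hMs] at hL
  obtain ⟨m, hm⟩ : ∃ m, m = if M ≤ n then M else 2 * n + 2 - M := ⟨_, rfl⟩
  refine ⟨fun k => c k + if k = m then c s else 0, fun k => ?_, fun i hi hin => ?_⟩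
  · have := hc k
    have := hc s
    positivity
  rw [hsplit i hi, genB_eq_add_single, add_comm]
  congr 1
  have hmono := hh.mono s i hs hi.le hin
  by_cases hmi : m ≤ i
  · have hsm : s + 1 ≤ m := by split_ifs at hm <;> omega
    rw [if_pos (Finset.mem_Icc.2 ⟨hsm, hmi⟩)]
    congr 1
    by_cases hMle : M ≤ n
    · rw [if_pos hMle] at hm
      rw [rootB, if_pos hMle, ← hm, sub_eq_zero] at hL
      simp only [rootB, hL]
    · rw [if_neg hMle] at hm
      rw [rootB, if_neg hMle, if_neg hMn, ← hm] at hL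
      have hfull : h i = 2 * n + 1 - i := by
        rcases hmono with h' | h'
        · exact h'
        · have := hh.apply_le i (by omega) hin
          omega
      rw [hfull]
      exact prod_rootB_mul_of_neg x hin (eq_neg_of_add_eq_zero_left hL)
  · rw [if_neg (by simp [hmi])]
    have hMmem : M ∈ Finset.Icc (i + 1) (h i) := by
      rw [Finset.mem_Icc]
      split_ifs at hm <;> omega
    rw [Finset.prod_eq_zero hMmem hL, zero_mul, smul_zero]

end Generators

section Main

variable {R : Type*} [CommRing R] [Algebra ℝ R]

/-- The list of generators `f^B_{i,h(i)}` for `s ≤ i < s + d`. -/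
def genListB (n : ℕ) (x : ℕ → R) (c : ℕ → ℝ) (h : ℕ → ℕ) (s d : ℕ) : List R :=
  (List.range' s d).map fun i => genB n x c s i (h i)

/-- The tail of `genListB`, still in terms of the variables from `x_s` on. -/
def genTailB (n : ℕ) (x : ℕ → R) (c : ℕ → ℝ) (h : ℕ → ℕ) (s d : ℕ) : List R :=
  (List.range' (s + 1) d).map fun i => genB n x c s i (h i)

lemma genListB_succ (n : ℕ) (x : ℕ → R) (c : ℕ → ℝ) (h : ℕ → ℕ) (s d : ℕ) :
    genListB n x c h s (d + 1) = genB n x c s s (h s) :: genTailB n x c h s d := rfl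

lemma genB_mem {I : Ideal R} {n : ℕ} {x : ℕ → R} {s i : ℕ}
    (hx : ∀ k, s ≤ k → k ≤ i → x k ∈ I) (c : ℕ → ℝ) (j : ℕ) : genB n x c s i j ∈ I := by
  refine sum_mem fun k hk => ?_
  rw [Finset.mem_Icc] at hk
  exact Submodule.smul_of_tower_mem I _ (Ideal.mul_mem_left _ _ (hx k hk.1 hk.2))

lemma genTailB_mem {I : Ideal R} {n : ℕ} {x : ℕ → R} {s d : ℕ} (hd : s + d = n)
    (hx : ∀ k, s ≤ k → k ≤ n → x k ∈ I) (c : ℕ → ℝ) (h : ℕ → ℕ) :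
    ∀ r ∈ genTailB n x c h s d, r ∈ I := by
  intro r hr
  obtain ⟨i, hi, rfl⟩ := List.mem_map.1 hr
  rw [List.mem_range'_1] at hi
  exact genB_mem (fun k h1 h2 => hx k h1 (by omega)) c _

variable [IsLocalRing R] [IsNoetherianRing R]

/-- Passing to the quotient by a linear factor of `f^B_{s,h(s)}`. -/
lemma exists_quotient_genTailB {n : ℕ} {h : ℕ → ℕ} (hh : IsHessB n h) {x : ℕ → R}
    {c : ℕ → ℝ} (hc : ∀ k, 0 < c k) {s d M : ℕ} (hd : s + d = n) (hs : 1 ≤ s) (hsM : s ≤ M)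
    (hM : M ≤ h s) (hx : ∀ k, s ≤ k → k ≤ n → x k ∈ maximalIdeal R)
    (hreg : IsWeaklyRegular R ((List.range' s (d + 1)).map x)) :
    IsSMulRegular R (linB n x s M) ∧
    IsWeaklyRegular (R ⧸ Ideal.span {linB n x s M})
      ((List.range' (s + 1) d).map fun k =>
        Ideal.Quotient.mkₐ ℝ (Ideal.span {linB n x s M}) (x k)) ∧
    ∃ c' : ℕ → ℝ, (∀ k, 0 < c' k) ∧
      (genTailB n x c h s d).map (Ideal.Quotient.mkₐ ℝ (Ideal.span {linB n x s M})) =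
        genListB n (fun k => Ideal.Quotient.mkₐ ℝ (Ideal.span {linB n x s M}) (x k)) c' h
          (s + 1) d := by
  have hmax := hh.apply_le s hs (by omega)
  have hL : linB n x s M ∈ maximalIdeal R := linB_mem (by omega) hx hsM (by omega)
  have hxs : ∀ r ∈ (List.range' (s + 1) d).map x, r ∈ maximalIdeal R := by
    intro r hr
    obtain ⟨k, hk, rfl⟩ := List.mem_map.1 hr
    rw [List.mem_range'_1] at hk
    exact hx k (by omega) (by omega)
  have H : IsWeaklyRegular R (linB n x s M :: (List.range' (s + 1) d).map x) :=
    IsWeaklyRegular.cons_congr hreg (hx s le_rfl (by omega)) hL hxs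
      (sub_linB_mem x hd hsM (by omega))
  rw [isWeaklyRegular_cons_iff_quotient] at H
  obtain ⟨c', hc', e⟩ := exists_genB_eq_of_linB_eq_zero hh
    (fun k => Ideal.Quotient.mkₐ ℝ (Ideal.span {linB n x s M}) (x k)) hc hs (by omega) hsM hM
    (by
      rw [← map_linB, Ideal.Quotient.mkₐ_eq_mk, Ideal.Quotient.eq_zero_iff_mem]
      exact Ideal.mem_span_singleton_self _)
  refine ⟨H.1, by simpa [List.map_map, Function.comp_def] using H.2, c', hc', ?_⟩
  rw [genTailB, genListB, List.map_map]
  refine List.map_congr_left fun i hi => ?_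
  rw [List.mem_range'_1] at hi
  rw [Function.comp_apply, map_genB, e i (by omega) (by omega)]

lemma isWeaklyRegular_linB_cons {n : ℕ} {h : ℕ → ℕ} (hh : IsHessB n h) {x : ℕ → R}
    {c : ℕ → ℝ} (hc : ∀ k, 0 < c k) {s d M : ℕ} (hd : s + d = n) (hs : 1 ≤ s) (hsM : s ≤ M)
    (hM : M ≤ h s) (hx : ∀ k, s ≤ k → k ≤ n → x k ∈ maximalIdeal R)
    (hreg : IsWeaklyRegular R ((List.range' s (d + 1)).map x))
    (hquot : ∀ c' : ℕ → ℝ, (∀ k, 0 < c' k) →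
      IsWeaklyRegular (R ⧸ Ideal.span {linB n x s M})
        (genListB n (fun k => Ideal.Quotient.mkₐ ℝ (Ideal.span {linB n x s M}) (x k)) c' h
          (s + 1) d)) :
    IsWeaklyRegular R (linB n x s M :: genTailB n x c h s d) := by
  obtain ⟨hL, -, c', hc', e⟩ := exists_quotient_genTailB hh hc hd hs hsM hM hx hreg
  rw [isWeaklyRegular_cons_iff_quotient]
  refine ⟨hL, ?_⟩
  have := hquot c' hc'
  rwa [← e] at this

lemma prod_Icc_mul_prod_Icc {A : Type*} [CommMonoid A] (f : ℕ → A) {a b M : ℕ}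
    (ha : a ≤ M + 1) (hb : M ≤ b) :
    (∏ j ∈ Finset.Icc a M, f j) * ∏ j ∈ Finset.Icc (M + 1) b, f j =
      ∏ j ∈ Finset.Icc a b, f j := by
  simp only [← Finset.Ico_add_one_right_eq_Icc]
  exact Finset.prod_Ico_consecutive f ha (by omega)

lemma mem_of_prod_mul_mem {ι A : Type*} [CommRing A] {I : Ideal A} (T : Finset ι) (f : ι → A)
    (hf : ∀ t ∈ T, ∀ y, f t * y ∈ I → y ∈ I) {y : A} (hy : (∏ t ∈ T, f t) * y ∈ I) : y ∈ I := by
  classical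
  induction T using Finset.induction_on with
  | empty => simpa using hy
  | insert a T ha ih =>
    rw [Finset.prod_insert ha, mul_assoc] at hy
    exact ih (fun t ht => hf t (Finset.mem_insert_of_mem ht))
      (hf a (Finset.mem_insert_self _ _) _ hy)

end Main

/-- The generators `f^B_{i,h(i)}` form a regular sequence in any Noetherian local ring in which
the variables do. -/
theorem isWeaklyRegular_genListB {n : ℕ} {h : ℕ → ℕ} (hh : IsHessB n h) (d : ℕ)
    {R : Type*} [CommRing R] [Algebra ℝ R] [IsLocalRing R] [IsNoetherianRing R] {x : ℕ → R}
    {c : ℕ → ℝ} (hc : ∀ k, 0 < c k) {s : ℕ} (hd : s + d = n + 1) (hs : 1 ≤ s)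
    (hx : ∀ k, s ≤ k → k ≤ n → x k ∈ maximalIdeal R)
    (hreg : IsWeaklyRegular R ((List.range' s d).map x)) :
    IsWeaklyRegular R (genListB n x c h s d) := by
  induction d generalizing R s c with
  | zero => exact IsWeaklyRegular.nil R R
  | succ d ih =>
    have hle := hh.le_apply s hs (by omega)
    have hmax := hh.apply_le s hs (by omega)
    have htail := genTailB_mem (by omega) hx c h (d := d)
    have hlin : ∀ M, s ≤ M → M ≤ h s → IsWeaklyRegular R (genTailB n x c h s d) ∧
        ∀ y, linB n x s M * y ∈ Ideal.ofList (genTailB n x c h s d) →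
          y ∈ Ideal.ofList (genTailB n x c h s d) := by
      intro M hsM hM
      have hL : linB n x s M ∈ maximalIdeal R := linB_mem (by omega) hx hsM (by omega)
      have := isLocalRing_quotient_span hL
      rw [← isWeaklyRegular_cons_iff_of_mem_maximalIdeal hL htail]
      refine isWeaklyRegular_linB_cons hh hc (by omega) hs hsM hM hx hreg fun c' hc' => ?_
      exact ih hc' (by omega) (by omega)
        (fun k h1 h2 => mk_mem_maximalIdeal _ (hx k (by omega) h2))
        (exists_quotient_genTailB hh hc (by omega) hs hsM hM hx hreg).2.1
    rw [genListB_succ, isWeaklyRegular_cons_iff_of_mem_maximalIdeal _ htail]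
    · refine ⟨(hlin s le_rfl hle).1, fun y hy => ?_⟩
      rw [genB_self n x c hle, smul_mul_assoc] at hy
      have hy' := Submodule.smul_of_tower_mem _ (c s)⁻¹ hy
      rw [inv_smul_smul₀ (hc s).ne'] at hy'
      exact mem_of_prod_mul_mem _ _
        (fun M hM => (hlin M (Finset.mem_Icc.1 hM).1 (Finset.mem_Icc.1 hM).2).2) hy'
    · exact genB_mem (fun k h1 h2 => hx k h1 (by omega)) c _

/-- The products of root labels indexed by functions `m` with `i ≤ m i ≤ h i` are linearly
independent modulo the generators `f^B_{i,h(i)}`. -/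
theorem coeff_eq_zero_of_sum_prod_rootB_mem {n : ℕ} {h : ℕ → ℕ} (hh : IsHessB n h) (d : ℕ)
    {R : Type*} [CommRing R] [Algebra ℝ R] [IsLocalRing R] [IsNoetherianRing R] {x : ℕ → R}
    {c : ℕ → ℝ} (hc : ∀ k, 0 < c k) {s : ℕ} (hd : s + d = n + 1) (hs : 1 ≤ s)
    (hx : ∀ k, s ≤ k → k ≤ n → x k ∈ maximalIdeal R)
    (hreg : IsWeaklyRegular R ((List.range' s d).map x))
    {ι : Type*} (T : Finset ι) (m : ι → ℕ → ℕ) (a : ι → ℝ)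
    (hm : ∀ t ∈ T, ∀ i, s ≤ i → i ≤ n → i ≤ m t i ∧ m t i ≤ h i)
    (hinj : ∀ t ∈ T, ∀ u ∈ T, (∀ i, s ≤ i → i ≤ n → m t i = m u i) → t = u)
    (hsum : ∑ t ∈ T, a t •
      ∏ i ∈ Finset.Icc s n, ∏ j ∈ Finset.Icc (m t i + 1) (h i), rootB n x i j ∈
        Ideal.ofList (genListB n x c h s d)) :
    ∀ t ∈ T, a t = 0 := by
  classical
  induction d generalizing R s c T with
  | zero =>
    intro t ht
    have hT : T = {t} := Finset.eq_singleton_iff_unique_mem.2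
      ⟨ht, fun u hu => hinj u hu t ht fun i h1 h2 => by omega⟩
    have hempty : Finset.Icc s n = ∅ := Finset.Icc_eq_empty (by omega)
    simpa [hT, hempty, genListB] using hsum
  | succ d ih =>
    by_contra! hne
    have hne' : (T.filter fun t => a t ≠ 0).Nonempty := by
      obtain ⟨t, ht, hat⟩ := hne
      exact ⟨t, Finset.mem_filter.2 ⟨ht, hat⟩⟩
    obtain ⟨t₀, ht₀, hmaxt⟩ := Finset.exists_max_image _ (fun t => m t s) hne'
    obtain ⟨ht₀T, hat₀⟩ := Finset.mem_filter.1 ht₀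
    obtain ⟨M, hMdef⟩ : ∃ M, M = m t₀ s := ⟨_, rfl⟩
    obtain ⟨hsM, hM⟩ := hm t₀ ht₀T s le_rfl (by omega)
    have hmax := hh.apply_le s hs (by omega)
    rw [← hMdef] at hsM hM
    have htail := genTailB_mem (by omega) hx c h (d := d)
    have hLmem : ∀ M, s ≤ M → M ≤ h s → linB n x s M ∈ maximalIdeal R :=
      fun M h1 h2 => linB_mem (by omega) hx h1 (by omega)
    have hlin : ∀ M, s ≤ M → M ≤ h s →
        ∀ y, linB n x s M * y ∈ Ideal.ofList (genTailB n x c h s d) →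
          y ∈ Ideal.ofList (genTailB n x c h s d) := by
      intro M hsM hM
      have hL := hLmem M hsM hM
      have := isLocalRing_quotient_span hL
      refine ((isWeaklyRegular_cons_iff_of_mem_maximalIdeal hL htail).1 ?_).2
      refine isWeaklyRegular_linB_cons hh hc (by omega) hs hsM hM hx hreg fun c' hc' => ?_
      exact isWeaklyRegular_genListB hh d hc' (by omega) (by omega)
        (fun k h1 h2 => mk_mem_maximalIdeal _ (hx k (by omega) h2))
        (exists_quotient_genTailB hh hc (by omega) hs hsM hM hx hreg).2.1
    -- The common factor of all summands.
    let A : R := ∏ j ∈ Finset.Icc (M + 1) (h s), linB n x s j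
    let P : ι → R := fun t =>
      ∏ i ∈ Finset.Icc (s + 1) n, ∏ j ∈ Finset.Icc (m t i + 1) (h i), rootB n x i j
    let Q : ι → R := fun t => ∏ j ∈ Finset.Icc (m t s + 1) M, linB n x s j
    have hfactor : ∀ t ∈ T.filter (fun t => a t ≠ 0),
        ∏ i ∈ Finset.Icc s n, ∏ j ∈ Finset.Icc (m t i + 1) (h i), rootB n x i j =
          A * (Q t * P t) := by
      intro t ht
      have h1 := hmaxt t ht
      have h2 := hm t (Finset.mem_filter.1 ht).1 s le_rfl (by omega)
      rw [← Finset.insert_Icc_add_one_left_eq_Icc (show s ≤ n by omega),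
        Finset.prod_insert (by simp), ← mul_assoc]
      refine congrArg (· * P t) ?_
      rw [mul_comm A, prod_Icc_mul_prod_Icc _ (by omega) hM]
      refine Finset.prod_congr rfl fun j hj => ?_
      rw [Finset.mem_Icc] at hj
      rw [linB, if_neg (by omega)]
    have hgen : genB n x c s s (h s) = A * genB n x c s s M := by
      rw [genB_self n x c (hsM.trans hM), genB_self n x c hsM, mul_smul_comm]
      congr 1
      rw [mul_comm A, prod_Icc_mul_prod_Icc _ (by omega) hM]
    -- Cancelling the common factor.
    have hcancel : ∑ t ∈ T with a t ≠ 0, a t • (Q t * P t) ∈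
        Ideal.span {linB n x s M} ⊔ Ideal.ofList (genTailB n x c h s d) := by
      rw [← Finset.sum_filter_of_ne (p := fun t => a t ≠ 0)
        (fun t _ h1 h2 => h1 (by rw [h2, zero_smul])),
        Finset.sum_congr rfl (fun t ht => by rw [hfactor t ht, ← mul_smul_comm]),
        ← Finset.mul_sum, genListB_succ, Ideal.ofList_cons, hgen, Submodule.mem_sup] at hsum
      obtain ⟨u, hu, v, hv, huv⟩ := hsum
      obtain ⟨g, rfl⟩ := Ideal.mem_span_singleton'.1 hu
      have hdiff : ∑ t ∈ T with a t ≠ 0, a t • (Q t * P t) - g * genB n x c s s M ∈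
          Ideal.ofList (genTailB n x c h s d) := by
        refine mem_of_prod_mul_mem (Finset.Icc (M + 1) (h s)) (linB n x s)
          (fun j hj => hlin j ?_ ?_) ?_
        · rw [Finset.mem_Icc] at hj; omega
        · rw [Finset.mem_Icc] at hj; omega
        · rw [mul_sub]
          convert hv using 1
          rw [← eq_sub_iff_add_eq'] at huv
          rw [huv]
          ring
      rw [← sub_add_cancel (∑ t ∈ T with a t ≠ 0, a t • (Q t * P t)) (g * genB n x c s s M)]
      refine add_mem (Ideal.mem_sup_right hdiff) (Ideal.mem_sup_left ?_)
      rw [genB_self n x c hsM]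
      refine Ideal.mul_mem_left _ _ (Submodule.smul_of_tower_mem _ _ ?_)
      exact Ideal.mem_span_singleton.2
        (Finset.dvd_prod_of_mem _ (Finset.right_mem_Icc.2 hsM))
    -- Passing to the quotient, only the summands with `m t s = M` survive.
    have hL := hLmem M hsM hM
    have hloc := isLocalRing_quotient_span hL
    obtain ⟨-, hreg', c', hc', e⟩ :=
      exists_quotient_genTailB hh hc (by omega) hs hsM hM hx hreg
    let φ := Ideal.Quotient.mkₐ ℝ (Ideal.span {linB n x s M})
    have hφL : φ (linB n x s M) = 0 := by
      rw [Ideal.Quotient.mkₐ_eq_mk, Ideal.Quotient.eq_zero_iff_mem]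
      exact Ideal.mem_span_singleton_self _
    have hterm : ∀ t ∈ (T.filter fun t => a t ≠ 0).filter fun t => m t s = M,
        φ (a t • (Q t * P t)) = a t • ∏ i ∈ Finset.Icc (s + 1) n,
          ∏ j ∈ Finset.Icc (m t i + 1) (h i), rootB n (fun k => φ (x k)) i j := by
      intro t ht
      have hQ : Q t = 1 := by simp [Q, (Finset.mem_filter.1 ht).2]
      simp only [map_smul, hQ, one_mul, P, map_prod, map_rootB]
    have hφ := Ideal.mem_map_of_mem φ hcancel
    have hmap : Ideal.map φ (Ideal.ofList (genTailB n x c h s d)) =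
        Ideal.ofList (genListB n (fun k => φ (x k)) c' h (s + 1) d) := by
      rw [← e]
      exact Ideal.map_ofList φ.toRingHom _
    rw [Ideal.map_sup, hmap, Ideal.map_span, Set.image_singleton, hφL,
      Ideal.span_singleton_eq_bot.2 rfl, bot_sup_eq, map_sum,
      ← Finset.sum_filter_of_ne (p := fun t => m t s = M)] at hφ
    · refine hat₀ (ih hc' (by omega) (by omega)
        (fun k h1 h2 => mk_mem_maximalIdeal _ (hx k (by omega) h2)) hreg'
        ((T.filter fun t => a t ≠ 0).filter fun t => m t s = M) ?_ ?_ ?_ t₀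
        (Finset.mem_filter.2 ⟨ht₀, hMdef.symm⟩))
      · intro t ht i h1 h2
        exact hm t (by simp only [Finset.mem_filter] at ht; exact ht.1.1) i (by omega) h2
      · intro t ht u hu htu
        simp only [Finset.mem_filter] at ht hu
        refine hinj t ht.1.1 u hu.1.1 fun i h1 h2 => ?_
        rcases h1.eq_or_lt with rfl | h1
        · rw [ht.2, hu.2]
        · exact htu i h1 h2
      · rw [Finset.sum_congr rfl hterm] at hφ
        exact hφ
    · intro t ht hne0
      by_contra hMne
      refine hne0 ?_
      have hlt : m t s + 1 ≤ M := by
        have := hmaxt t ht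
        omega
      rw [map_smul, map_mul, map_prod,
        Finset.prod_eq_zero (Finset.right_mem_Icc.2 hlt) hφL, zero_mul, smul_zero]

lemma isWeaklyRegular_map_X {σ K : Type*} [Field K] (l : List σ) (hl : l.Nodup) :
    IsWeaklyRegular (MvPolynomial σ K) (l.map (X : σ → MvPolynomial σ K)) := by
  induction l using List.reverseRecOn with
  | nil => exact IsWeaklyRegular.nil _ _
  | append_singleton l a ih =>
    rw [List.nodup_append] at hl
    rw [List.map_append, List.map_singleton, isWeaklyRegular_concat_iff]
    refine ⟨ih hl.1, fun y hy => ?_⟩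
    have e : Ideal.ofList (l.map (X : σ → MvPolynomial σ K)) =
        Ideal.span (X '' {i | i ∈ l}) := by
      refine congrArg Ideal.span (Set.ext fun p => ?_)
      simp
    rw [e, mem_ideal_span_X_image] at hy ⊢
    intro μ hμ
    obtain ⟨i, hi, hne⟩ := hy (Finsupp.single a 1 + μ) (by
      rw [mem_support_iff, coeff_X_mul]
      exact mem_support_iff.1 hμ)
    have hia : a ≠ i := fun e => hl.2.2 i hi a (by simp) e.symm
    exact ⟨i, hi, by simpa [Finsupp.single_apply, hia] using hne⟩

lemma isWeaklyRegular_map_xv (n : ℕ) :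
    IsWeaklyRegular (MvPolynomial (Fin n) ℝ) ((List.range' 1 n).map (xv n)) := by
  have e : (List.range' 1 n).map (xv n) = (List.finRange n).map X := by
    refine List.ext_getElem (by simp) fun i h1 h2 => ?_
    simp only [List.length_map, List.length_range'] at h1
    simp [xv, show 1 + i ≤ n by omega]
  rw [e]
  exact isWeaklyRegular_map_X _ (List.nodup_finRange n)

lemma alB_eq_rootB (n i j : ℕ) : alB n i j = rootB n (xv n) i j := rfl

lemma fBij_eq_genB (n i j : ℕ) : fBij n i j = genB n (xv n) (fun _ => 1) 1 i j := by
  simp only [fBij, genB, one_smul, alB_eq_rootB]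

lemma IBh_eq_ofList (n : ℕ) (h : ℕ → ℕ) :
    IBh n h = Ideal.ofList (genListB n (xv n) (fun _ => 1) h 1 n) := by
  rw [IBh]
  congr 1
  ext p
  simp only [genListB, fBij_eq_genB, Set.mem_image, Set.mem_Icc, Set.mem_ofPred_eq, List.mem_map,
    List.mem_range'_1, Nat.lt_one_add_iff]

lemma isHessB_of_forall {n : ℕ} {h : ℕ → ℕ}
    (hh1 : ∀ i ∈ Finset.Icc 1 n, i ≤ h i ∧ h i ≤ 2 * n + 1 - i)
    (hh2 : ∀ i ∈ Finset.Icc 1 (n - 1), h i ≠ 2 * n + 1 - i → h i ≤ h (i + 1))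
    (hh3 : ∀ i ∈ Finset.Icc 1 (n - 1), h i = 2 * n + 1 - i →
      h (i + 1) = 2 * n + 1 - (i + 1)) : IsHessB n h where
  le_apply i h1 h2 := (hh1 i (Finset.mem_Icc.2 ⟨h1, h2⟩)).1
  apply_le i h1 h2 := (hh1 i (Finset.mem_Icc.2 ⟨h1, h2⟩)).2
  mono s i hs hsi := by
    induction i, hsi using Nat.le_induction with
    | base => exact fun _ => Or.inr le_rfl
    | succ i hsi ih =>
      intro hin
      have hi : i ∈ Finset.Icc 1 (n - 1) := Finset.mem_Icc.2 ⟨by omega, by omega⟩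
      by_cases hfull : h i = 2 * n + 1 - i
      · exact Or.inl (hh3 i hi hfull)
      · exact Or.inr (((ih (by omega)).resolve_left hfull).trans (hh2 i hi hfull))

/-- **Theorem 7.1 (type B).** For a Hessenberg function `h` of type `B_n`, the classes
`P_{h'} = ∏_{i=1}^{n} ∏_{j=h'(i)+1}^{h(i)} α^{B}_{i,j}` in `R^{B}_h ≅ H^*(Hess(N,h))` —
which are, up to nonzero scalars, the Poincaré duals `[Hess(N,h')]` of the smaller regular
nilpotent Hessenberg varieties — are linearly independent over ℝ. -/
theorem stmt_16 (n : ℕ) (hn : 1 ≤ n) (h : ℕ → ℕ)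
    (hh1 : ∀ i ∈ Finset.Icc 1 n, i ≤ h i ∧ h i ≤ 2 * n + 1 - i)
    (hh2 : ∀ i ∈ Finset.Icc 1 (n - 1), h i ≠ 2 * n + 1 - i → h i ≤ h (i + 1))
    (hh3 : ∀ i ∈ Finset.Icc 1 (n - 1), h i = 2 * n + 1 - i → h (i + 1) = 2 * n + 1 - (i + 1)) :
    LinearIndependent ℝ (fun h' : HessSubB n h =>
      Ideal.Quotient.mk (IBh n h)
        (∏ i ∈ Finset.Icc 1 n, ∏ j ∈ Finset.Icc (h'.1 i + 1) (h i), alB n i j)) := by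
  have hh := isHessB_of_forall hh1 hh2 hh3
  rw [linearIndependent_iff']
  intro T a hsum
  let p : Ideal (MvPolynomial (Fin n) ℝ) := RingHom.ker (constantCoeff (R := ℝ) (σ := Fin n))
  have hp : p.IsPrime := RingHom.ker_isPrime _
  let φ : MvPolynomial (Fin n) ℝ →ₐ[ℝ] Localization.AtPrime p :=
    IsScalarTower.toAlgHom ℝ _ (Localization.AtPrime p)
  have hnoeth : IsNoetherianRing (Localization.AtPrime p) :=
    IsLocalization.isNoetherianRing p.primeCompl _ inferInstance
  have hmem : ∑ t ∈ T, a t • (∏ i ∈ Finset.Icc 1 n,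
      ∏ j ∈ Finset.Icc (t.1 i + 1) (h i), alB n i j) ∈ IBh n h := by
    rw [← Ideal.Quotient.eq_zero_iff_mem, ← Ideal.Quotient.mkₐ_eq_mk ℝ, map_sum]
    simpa only [map_smul, Ideal.Quotient.mkₐ_eq_mk] using hsum
  have hφ := Ideal.mem_map_of_mem φ hmem
  have hmap : Ideal.map φ (IBh n h) =
      Ideal.ofList (genListB n (fun k => φ (xv n k)) (fun _ => 1) h 1 n) := by
    rw [IBh_eq_ofList]
    refine (Ideal.map_ofList φ.toRingHom _).trans ?_
    simp only [genListB, List.map_map]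
    congr 2
    simp only [← map_genB]
    rfl
  rw [hmap, map_sum] at hφ
  simp only [map_smul, map_prod, alB_eq_rootB, map_rootB] at hφ
  refine coeff_eq_zero_of_sum_prod_rootB_mem hh n (fun _ => one_pos) (by omega) le_rfl
    (fun k h1 h2 => ?_) ?_ T (fun t => t.1) a ?_ ?_ hφ
  · refine (IsLocalization.AtPrime.to_map_mem_maximal_iff _ p _).2 ?_
    simp [p, xv, h1, h2]
  · have := (isWeaklyRegular_map_xv n).of_isLocalization (Localization.AtPrime p) p.primeCompl
    rwa [List.map_map] at this
  · intro t _ i h1 h2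
    have hi := Finset.mem_Icc.2 ⟨h1, h2⟩
    exact ⟨(t.2.1 i hi).1, t.2.2.2.2.2 i hi⟩
  · intro t _ u _ htu
    refine Subtype.ext (funext fun i => ?_)
    by_cases hi : i ∈ Finset.Icc 1 n
    · exact htu i (Finset.mem_Icc.1 hi).1 (Finset.mem_Icc.1 hi).2
    · rw [t.2.2.2.2.1 i hi, u.2.2.2.2.1 i hi]
end
end

section
/- Let h be a Hessenberg function for type G_2. For each Hessenberg function h' for type G_2 with h'(1) ≤ h(1) and h'(2) ≤ h(2), let P_{h'} denote the class of (∏_{j=h'(1)+1}^{h(1)} α_{1,j})·(∏_{j=h'(2)+1}^{h(2)} α_{2,j}) in R^{G}_{h} (this class equals, up to a nonzero scalar, the Poincaré dual [Hess(N,h')] of the smaller regular nilpotent Hessenberg variety inside Hess(N,h)). Then the family {P_{h'} : h' a Hessenberg function with h' ≤ h pointwise} is linearly independent over ℝ in R^{G}_{h}. -/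
open MvPolynomial

noncomputable section

/-- The type `G_2` root labels `α_{1,j}` for `j = 2,…,6`, in `ℝ[x_1,x_2,x_3]`. -/
def alG1 : ℕ → MvPolynomial (Fin 3) ℝ
  | 2 => X 0 - X 1
  | 3 => -X 0 + X 2
  | 4 => -X 1 + X 2
  | 5 => X 0 - 2 * X 1 + X 2
  | 6 => -X 0 - X 1 + 2 * X 2
  | _ => 0

/-- The type `G_2` root label `α_{2,3} = −2x_1+x_2+x_3`. -/
def alG2 (j : ℕ) : MvPolynomial (Fin 3) ℝ :=
  if j = 3 then -2 * X 0 + X 1 + X 2 else 0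

/-- `f_{1,j} = (∏_{ℓ=2}^{j} α_{1,ℓ})·(−x_2+x_3)` (in particular `f_{1,1} = −x_2+x_3`). -/
def fG1 (j : ℕ) : MvPolynomial (Fin 3) ℝ :=
  (∏ ℓ ∈ Finset.Icc 2 j, alG1 ℓ) * (-X 1 + X 2)

/-- `f_{2,2} = x_3` and `f_{2,3} = x_1²+x_2²+x_3²`. -/
def fG2 (j : ℕ) : MvPolynomial (Fin 3) ℝ :=
  if j = 2 then X 2 else X 0 ^ 2 + X 1 ^ 2 + X 2 ^ 2

/-- `f_{3,3} = x_1+x_2+x_3`. -/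
def fG3 : MvPolynomial (Fin 3) ℝ := X 0 + X 1 + X 2

/-- The ideal `(f_{1,h(1)}, f_{2,h(2)}, f_{3,3})`, so that
`R^{G}_h = ℝ[x_1,x_2,x_3]/IG h ≅ H^*(Hess(N,h);ℝ)` in type `G_2`. -/
def IG (h : ℕ → ℕ) : Ideal (MvPolynomial (Fin 3) ℝ) :=
  Ideal.span {fG1 (h 1), fG2 (h 2), fG3}

/-- Hessenberg functions of type `G_2` below `h`, recorded as the pair of values
`(h'(1), h'(2))` (with `h'(3) = 3`): the index set of the Poincaré duals
`[Hess(N,h')]`. -/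
def HessSubG (h : ℕ → ℕ) : Type :=
  {q : ℕ × ℕ //
    (1 ≤ q.1 ∧ q.1 ≤ 6) ∧ (2 ≤ q.2 ∧ q.2 ≤ 3) ∧ (3 ≤ q.1 → q.2 = 3) ∧
    q.1 ≤ h 1 ∧ q.2 ≤ h 2}

/-- Classes modulo an ideal are linearly independent as soon as each of them is separated from the
others by a linear functional vanishing on the ideal. -/
lemma linearIndependent_mk_of_separating {K A ι : Type*} [Field K] [CommRing A] [Algebra K A]
    (I : Ideal A) (v : ι → A)
    (H : ∀ i, ∃ L : A →ₗ[K] K, (∀ p ∈ I, L p = 0) ∧ (∀ j, j ≠ i → L (v j) = 0) ∧ L (v i) ≠ 0) :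
    LinearIndependent K (fun i => Ideal.Quotient.mk I (v i)) := by
  rw [linearIndependent_iff']
  intro s g hg i hi
  obtain ⟨L, hI, hj, hne⟩ := H i
  have hmem : ∑ j ∈ s, g j • v j ∈ I := by
    rw [← Ideal.Quotient.eq_zero_iff_mem, map_sum, ← hg]
    exact Finset.sum_congr rfl fun j _ => rfl
  have h0 := hI _ hmem
  rw [map_sum, Finset.sum_eq_single i] at h0
  · simpa [hne] using h0
  · intro j _ hji
    simp [hj j hji]
  · exact fun h => absurd hi h

/-- Restriction of a real polynomial to the complex line spanned by `c`. -/
def lineHom (c : Fin 3 → ℂ) : MvPolynomial (Fin 3) ℝ →ₐ[ℝ] Polynomial ℂ :=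
  aeval fun i => Polynomial.monomial 1 (c i)

lemma lineHom_X (c : Fin 3 → ℂ) (i : Fin 3) : lineHom c (X i) = Polynomial.monomial 1 (c i) := by
  simp [lineHom]

lemma lineHom_alG1 (c : Fin 3 → ℂ) (j : ℕ) :
    lineHom c (alG1 j) = Polynomial.monomial 1 (aeval c (alG1 j)) := by
  have h2 : lineHom c 2 = Polynomial.C 2 := map_ofNat (lineHom c) 2
  unfold alG1
  split <;>
    simp [lineHom_X, h2, ← Polynomial.C_mul_X_pow_eq_monomial] <;>
    ring

lemma lineHom_alG2 (c : Fin 3 → ℂ) (j : ℕ) :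
    lineHom c (alG2 j) = Polynomial.monomial 1 (aeval c (alG2 j)) := by
  have h2 : lineHom c 2 = Polynomial.C 2 := map_ofNat (lineHom c) 2
  unfold alG2
  split_ifs <;>
    simp [lineHom_X, h2, ← Polynomial.C_mul_X_pow_eq_monomial]
  ring

lemma prod_monomial_one {ι : Type*} (s : Finset ι) (u : ι → ℂ) :
    ∏ j ∈ s, Polynomial.monomial 1 (u j) = Polynomial.monomial s.card (∏ j ∈ s, u j) := by
  classical
  induction s using Finset.induction_on with
  | empty => simp
  | insert a s ha ih =>
    rw [Finset.prod_insert ha, Finset.prod_insert ha, ih, Polynomial.monomial_mul_monomial,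
      Finset.card_insert_of_notMem ha, add_comm]

/-- The product of the values at `c` of the roots `α_{1,j}` with `a < j ≤ n`. -/
def rootProd (c : Fin 3 → ℂ) (a n : ℕ) : ℂ := ∏ j ∈ Finset.Icc (a + 1) n, aeval c (alG1 j)

lemma lineHom_prod_alG1 (c : Fin 3 → ℂ) (a n : ℕ) :
    lineHom c (∏ j ∈ Finset.Icc (a + 1) n, alG1 j) =
      Polynomial.monomial (n - a) (rootProd c a n) := by
  rw [map_prod, Finset.prod_congr rfl fun j _ => lineHom_alG1 c j, prod_monomial_one]
  simp [rootProd]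

lemma lineHom_prod_alG2 (c : Fin 3 → ℂ) (b n : ℕ) :
    lineHom c (∏ j ∈ Finset.Icc (b + 1) n, alG2 j) =
      Polynomial.monomial (n - b) (∏ j ∈ Finset.Icc (b + 1) n, aeval c (alG2 j)) := by
  rw [map_prod, Finset.prod_congr rfl fun j _ => lineHom_alG2 c j, prod_monomial_one]
  simp

lemma lineHom_fG1 (c : Fin 3 → ℂ) {n : ℕ} (hn : 1 ≤ n) :
    lineHom c (fG1 n) = Polynomial.monomial n (rootProd c 1 n * (-c 1 + c 2)) := by
  have h := lineHom_prod_alG1 c 1 n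
  norm_num at h
  rw [fG1, map_mul, map_prod, h, map_add, map_neg, lineHom_X, lineHom_X, ← map_neg, ← map_add,
    Polynomial.monomial_mul_monomial, Nat.sub_add_cancel hn]

lemma lineHom_coeff_zero (c : Fin 3 → ℂ) (p : MvPolynomial (Fin 3) ℝ) :
    ((lineHom c p).coeff 0).im = 0 := by
  induction p using MvPolynomial.induction_on with
  | C a => simp [lineHom, Polynomial.algebraMap_apply]
  | add p q hp hq => simp [hp, hq]
  | mul_X p i _ => simp [lineHom_X, Polynomial.mul_coeff_zero, Polynomial.coeff_monomial]

/-- If `c` is a zero of the other two generators, the image of the ideal on the line spanned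
by `c` consists of multiples of the image of `f_{1,h(1)}`. -/
lemma lineHom_of_mem_IG {c : Fin 3 → ℂ} {h : ℕ → ℕ} (h2 : lineHom c (fG2 (h 2)) = 0)
    (h3 : lineHom c fG3 = 0) {p : MvPolynomial (Fin 3) ℝ} (hp : p ∈ IG h) :
    ∃ g, lineHom c p = lineHom c g * lineHom c (fG1 (h 1)) := by
  obtain ⟨g, z, hz, rfl⟩ := Ideal.mem_span_insert.mp hp
  obtain ⟨a, b, rfl⟩ := Ideal.mem_span_pair.mp hz
  exact ⟨g, by simp [h2, h3]⟩

lemma coeff_lineHom_eq_zero_of_mem_IG {c : Fin 3 → ℂ} {h : ℕ → ℕ} (h1 : 1 ≤ h 1)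
    (h2 : lineHom c (fG2 (h 2)) = 0) (h3 : lineHom c fG3 = 0) {p : MvPolynomial (Fin 3) ℝ}
    (hp : p ∈ IG h) {d : ℕ} (hd : d < h 1) : (lineHom c p).coeff d = 0 := by
  obtain ⟨g, hg⟩ := lineHom_of_mem_IG h2 h3 hp
  rw [hg, lineHom_fG1 c h1, ← Polynomial.C_mul_X_pow_eq_monomial, ← mul_assoc,
    Polynomial.coeff_mul_X_pow', if_neg (by omega)]

lemma exists_coeff_lineHom_of_mem_IG {c : Fin 3 → ℂ} {h : ℕ → ℕ} (h1 : 1 ≤ h 1)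
    (h2 : lineHom c (fG2 (h 2)) = 0) (h3 : lineHom c fG3 = 0) {p : MvPolynomial (Fin 3) ℝ}
    (hp : p ∈ IG h) :
    ∃ z : ℂ, z.im = 0 ∧
      (lineHom c p).coeff (h 1) = z * (rootProd c 1 (h 1) * (-c 1 + c 2)) := by
  obtain ⟨g, hg⟩ := lineHom_of_mem_IG h2 h3 hp
  refine ⟨_, lineHom_coeff_zero c g, ?_⟩
  rw [hg, lineHom_fG1 c h1, ← Polynomial.C_mul_X_pow_eq_monomial, ← mul_assoc,
    Polynomial.coeff_mul_X_pow', if_pos le_rfl, Nat.sub_self, Polynomial.coeff_mul_C]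

/-- The functional taking the imaginary part of `w` times the `d`-th coefficient of the
restriction to the line spanned by `c`. -/
def lineFunctional (c : Fin 3 → ℂ) (d : ℕ) (w : ℂ) : MvPolynomial (Fin 3) ℝ →ₗ[ℝ] ℝ :=
  Complex.imLm ∘ₗ LinearMap.mulLeft ℝ w ∘ₗ (Polynomial.lcoeff ℂ d).restrictScalars ℝ ∘ₗ
    (lineHom c).toLinearMap

lemma lineFunctional_apply (c : Fin 3 → ℂ) (d : ℕ) (w : ℂ) (p : MvPolynomial (Fin 3) ℝ) :
    lineFunctional c d w p = (w * (lineHom c p).coeff d).im := rfl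

lemma rootProd_ne_zero {c : Fin 3 → ℂ} {a n : ℕ} (ha : 1 ≤ a)
    (hc : ∀ j, 2 ≤ j → j ≤ n → aeval c (alG1 j) ≠ 0) : rootProd c a n ≠ 0 := by
  rw [rootProd, Finset.prod_ne_zero_iff]
  intro j hj
  rw [Finset.mem_Icc] at hj
  exact hc j (by omega) (by omega)

lemma rootProd_one {c : Fin 3 → ℂ} {n : ℕ} (hn : 2 ≤ n) :
    rootProd c 1 n = (c 0 - c 1) * rootProd c 2 n := by
  rw [rootProd, rootProd, ← Finset.mul_prod_Ioc_eq_prod_Icc (by omega)]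
  congr 1
  simp [alG1]

/-- The class representative indexed by `(a, b)`. -/
def dualPoly (m n a b : ℕ) : MvPolynomial (Fin 3) ℝ :=
  (∏ j ∈ Finset.Icc (a + 1) m, alG1 j) * ∏ j ∈ Finset.Icc (b + 1) n, alG2 j

lemma coeff_lineHom_dualPoly_self (c : Fin 3 → ℂ) (m n a d : ℕ) :
    (lineHom c (dualPoly m n a n)).coeff d = if m - a = d then rootProd c a m else 0 := by
  rw [dualPoly, map_mul, lineHom_prod_alG1, lineHom_prod_alG2, Polynomial.monomial_mul_monomial,
    Polynomial.coeff_monomial]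
  simp

lemma coeff_lineHom_dualPoly_three_two (c : Fin 3 → ℂ) (m a d : ℕ) :
    (lineHom c (dualPoly m 3 a 2)).coeff d =
      if m - a + 1 = d then rootProd c a m * (-2 * c 0 + c 1 + c 2) else 0 := by
  rw [dualPoly, map_mul, lineHom_prod_alG1, lineHom_prod_alG2, Polynomial.monomial_mul_monomial,
    Polynomial.coeff_monomial]
  simp [alG2]

lemma dual_linearIndependent_two (h : ℕ → ℕ) (hh1 : 1 ≤ h 1 ∧ h 1 ≤ 2) (hh2 : h 2 = 2) :
    LinearIndependent ℝ (fun q : HessSubG h =>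
      Ideal.Quotient.mk (IG h) (dualPoly (h 1) (h 2) q.1.1 q.1.2)) := by
  apply linearIndependent_mk_of_separating
  rintro ⟨⟨a, b⟩, ⟨ha, -⟩, ⟨hb, -⟩, -, ha', hb'⟩
  dsimp only at ha hb ha' hb' ⊢
  obtain rfl : b = 2 := by omega
  have h2 : lineHom ![1, -1, 0] (fG2 (h 2)) = 0 := by simp [fG2, hh2, lineHom_X]
  have h3 : lineHom ![1, -1, 0] fG3 = 0 := by
    simp only [fG3, map_add, lineHom_X]
    simp
  have hne : rootProd ![1, -1, 0] a (h 1) ≠ 0 := by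
    refine rootProd_ne_zero ha fun j hj hj' => ?_
    obtain rfl : j = 2 := by omega
    norm_num [alG1]
  refine ⟨lineFunctional ![1, -1, 0] (h 1 - a) (Complex.I * (rootProd ![1, -1, 0] a (h 1))⁻¹),
    fun p hp => ?_, ?_, ?_⟩
  · rw [lineFunctional_apply, coeff_lineHom_eq_zero_of_mem_IG hh1.1 h2 h3 hp (by omega)]
    simp
  · rintro ⟨⟨a', b'⟩, hq'⟩ hq
    obtain ⟨-, ⟨hb₁, -⟩, -, ha₁, hb₂⟩ := id hq'
    dsimp only at hb₁ ha₁ hb₂ ⊢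
    obtain rfl : b' = 2 := by omega
    have : a' ≠ a := by
      rintro rfl
      exact hq rfl
    rw [hh2, lineFunctional_apply, coeff_lineHom_dualPoly_self, if_neg (by omega)]
    simp
  · rw [hh2, lineFunctional_apply, coeff_lineHom_dualPoly_self, if_pos rfl, mul_assoc,
      inv_mul_cancel₀ hne]
    simp

/-- A primitive cube root of unity. -/
def omegaG : ℂ := ⟨-1 / 2, √3 / 2⟩

lemma omegaG_sq : omegaG ^ 2 = -1 - omegaG := by
  have h : √3 * √3 = 3 := Real.mul_self_sqrt (by norm_num)
  apply Complex.ext <;> simp [omegaG, pow_two] <;> linarith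

lemma omegaG_im_ne : omegaG.im ≠ 0 := by simp [omegaG]

/-- The isotropic line on which both basic invariants vanish. -/
def isoVec : Fin 3 → ℂ := ![1, omegaG, -1 - omegaG]

lemma lineHom_isoVec_fG2 : lineHom isoVec (fG2 3) = 0 := by
  have : (1 : ℂ) + omegaG ^ 2 + (-1 - omegaG) ^ 2 = 0 := by linear_combination 2 * omegaG_sq
  rw [fG2, if_neg (by norm_num)]
  simp only [map_add, map_pow, lineHom_X, Polynomial.monomial_pow]
  rw [← map_add, ← map_add]
  simp [isoVec, this]

lemma lineHom_isoVec_fG3 : lineHom isoVec fG3 = 0 := by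
  rw [fG3, map_add, map_add, lineHom_X, lineHom_X, lineHom_X, ← map_add, ← map_add]
  simp [isoVec]

lemma isoVec_root_ne_zero (j : ℕ) (hj : 2 ≤ j) (hj' : j ≤ 6) : aeval isoVec (alG1 j) ≠ 0 := by
  have him := omegaG_im_ne
  intro h0
  have h1 := congrArg Complex.im h0
  interval_cases j <;> simp [alG1, isoVec] at h1 <;> apply him <;> linarith

lemma dual_linearIndependent_three (h : ℕ → ℕ) (hh1 : 1 ≤ h 1 ∧ h 1 ≤ 6) (hh2 : h 2 = 3) :
    LinearIndependent ℝ (fun q : HessSubG h =>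
      Ideal.Quotient.mk (IG h) (dualPoly (h 1) (h 2) q.1.1 q.1.2)) := by
  have h2 : lineHom isoVec (fG2 (h 2)) = 0 := by rw [hh2, lineHom_isoVec_fG2]
  have h3 := lineHom_isoVec_fG3
  have hA {a : ℕ} (ha : 1 ≤ a) : rootProd isoVec a (h 1) ≠ 0 :=
    rootProd_ne_zero ha fun j hj hj' => isoVec_root_ne_zero j hj (by omega)
  have him := omegaG_im_ne
  have hv : -2 * isoVec 0 + isoVec 1 + isoVec 2 = -3 := by simp [isoVec]; ring
  have hu : isoVec 0 - isoVec 1 = 1 - omegaG := by simp [isoVec]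
  have hf : -isoVec 1 + isoVec 2 = -1 - 2 * omegaG := by simp [isoVec]; ring
  have hf0 : -1 - 2 * omegaG ≠ 0 := fun e => him (by simpa using congrArg Complex.im e)
  apply linearIndependent_mk_of_separating
  -- It suffices to separate by one coefficient, weighted by a suitable complex number.
  suffices key : ∀ q : HessSubG h, ∃ d w,
      (d < h 1 ∨ d = h 1 ∧ w = (rootProd isoVec 1 (h 1) * (-1 - 2 * omegaG))⁻¹) ∧
      (∀ q' : HessSubG h, q' ≠ q →
        lineFunctional isoVec d w (dualPoly (h 1) 3 q'.1.1 q'.1.2) = 0) ∧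
      lineFunctional isoVec d w (dualPoly (h 1) 3 q.1.1 q.1.2) ≠ 0 by
    intro q
    obtain ⟨d, w, hd, hne, hq⟩ := key q
    refine ⟨lineFunctional isoVec d w, fun p hp => ?_, by simpa only [hh2] using hne,
      by simpa only [hh2] using hq⟩
    rcases hd with hd | ⟨rfl, rfl⟩
    · rw [lineFunctional_apply, coeff_lineHom_eq_zero_of_mem_IG hh1.1 h2 h3 hp hd]
      simp
    · obtain ⟨z, hz, hpz⟩ := exists_coeff_lineHom_of_mem_IG hh1.1 h2 h3 hp
      rw [lineFunctional_apply, hpz, hf, mul_left_comm,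
        inv_mul_cancel₀ (mul_ne_zero (hA le_rfl) hf0), mul_one, hz]
  rintro ⟨⟨a, b⟩, hq₀⟩
  obtain ⟨⟨ha, -⟩, ⟨hb, hb3⟩, hab, hah, -⟩ := id hq₀
  dsimp only at ha hb hb3 hab hah ⊢
  have others {d : ℕ} {w : ℂ}
      (H3 : ∀ a', 1 ≤ a' → a' ≤ h 1 → (a', 3) ≠ (a, b) → h 1 - a' = d →
        (w * rootProd isoVec a' (h 1)).im = 0)
      (H2 : ∀ a', 1 ≤ a' → a' ≤ 2 → a' ≤ h 1 → (a', 2) ≠ (a, b) → h 1 - a' + 1 = d →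
        (w * (rootProd isoVec a' (h 1) * -3)).im = 0)
      (q' : HessSubG h) (hq : q'.1 ≠ (a, b)) :
      lineFunctional isoVec d w (dualPoly (h 1) 3 q'.1.1 q'.1.2) = 0 := by
    obtain ⟨⟨a', b'⟩, hq'⟩ := q'
    obtain ⟨⟨ha₁, -⟩, ⟨hb₁, hb₂⟩, hab₁, hah₁, -⟩ := id hq'
    dsimp only at ha₁ hb₁ hb₂ hab₁ hah₁ hq ⊢
    rw [lineFunctional_apply]
    obtain rfl | rfl : b' = 2 ∨ b' = 3 := by omega
    · rw [coeff_lineHom_dualPoly_three_two, hv]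
      split_ifs with hd
      · exact H2 a' ha₁ (by omega) hah₁ hq hd
      · simp
    · rw [coeff_lineHom_dualPoly_self]
      split_ifs with hd
      · exact H3 a' ha₁ hah₁ hq hd
      · simp
  have others' {d : ℕ} {w : ℂ} H3 H2 (q' : HessSubG h)
      (hq : q' ≠ ⟨(a, b), hq₀⟩) :=
    others (d := d) (w := w) H3 H2 q' fun e => hq (Subtype.ext e)
  obtain rfl | rfl : b = 3 ∨ b = 2 := by omega
  · by_cases hcase : a = 1 ∧ 2 ≤ h 1
    · obtain ⟨rfl, hh⟩ := hcase
      refine ⟨h 1 - 1, (rootProd isoVec 2 (h 1))⁻¹, Or.inl (by omega), others' ?_ ?_, ?_⟩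
      · intro a' _ _ hne hd
        exact absurd (by rw [show a' = 1 by omega]) hne
      · intro a' _ _ _ _ hd
        obtain rfl : a' = 2 := by omega
        rw [inv_mul_cancel_left₀ (hA (by norm_num))]
        simp
      · rw [lineFunctional_apply, coeff_lineHom_dualPoly_self, if_pos rfl, rootProd_one hh,
          mul_left_comm, inv_mul_cancel₀ (hA (by norm_num)), hu]
        simpa using him
    · refine ⟨h 1 - a, Complex.I * (rootProd isoVec a (h 1))⁻¹, Or.inl (by omega),
        others' ?_ ?_, ?_⟩
      · intro a' _ _ hne hd
        exact absurd (by rw [show a' = a by omega]) hne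
      · intro a' _ _ _ _ hd
        omega
      · rw [lineFunctional_apply, coeff_lineHom_dualPoly_self, if_pos rfl, mul_assoc,
          inv_mul_cancel₀ (hA ha)]
        simp
  · obtain rfl | rfl : a = 1 ∨ a = 2 := by omega
    · refine ⟨h 1, (rootProd isoVec 1 (h 1) * (-1 - 2 * omegaG))⁻¹, Or.inr ⟨rfl, rfl⟩,
        others' ?_ ?_, ?_⟩
      · intro a' _ _ _ hd
        omega
      · intro a' _ _ _ hne hd
        exact absurd (by rw [show a' = 1 by omega]) hne
      · have hval : (rootProd isoVec 1 (h 1) * (-1 - 2 * omegaG))⁻¹ *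
            (rootProd isoVec 1 (h 1) * -3) = -1 - 2 * omegaG := by
          rw [inv_mul_eq_iff_eq_mul₀ (mul_ne_zero (hA le_rfl) hf0)]
          linear_combination -4 * rootProd isoVec 1 (h 1) * omegaG_sq
        rw [lineFunctional_apply, coeff_lineHom_dualPoly_three_two, if_pos (by omega), hv, hval]
        simpa using him
    · refine ⟨h 1 - 1, (rootProd isoVec 1 (h 1))⁻¹, Or.inl (by omega), others' ?_ ?_, ?_⟩
      · intro a' _ _ _ hd
        obtain rfl : a' = 1 := by omega
        rw [inv_mul_cancel₀ (hA le_rfl)]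
        simp
      · intro a' _ _ _ hne hd
        exact absurd (by rw [show a' = 2 by omega]) hne
      · have hval : (rootProd isoVec 1 (h 1))⁻¹ * (rootProd isoVec 2 (h 1) * -3) =
            -2 - omegaG := by
          rw [inv_mul_eq_iff_eq_mul₀ (hA le_rfl), rootProd_one hah, hu]
          linear_combination -rootProd isoVec 2 (h 1) * omegaG_sq
        rw [lineFunctional_apply, coeff_lineHom_dualPoly_three_two, if_pos (by omega), hv, hval]
        simpa using him

/-- **Theorem 7.1 (type G₂).** For a Hessenberg function `h` of type `G_2`, the classes
`P_{h'} = (∏_{j=h'(1)+1}^{h(1)} α_{1,j})·(∏_{j=h'(2)+1}^{h(2)} α_{2,j})` in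
`R^{G}_h ≅ H^*(Hess(N,h))` — which are, up to nonzero scalars, the Poincaré duals
`[Hess(N,h')]` of the smaller regular nilpotent Hessenberg varieties — are linearly
independent over ℝ. -/
theorem stmt_19 (h : ℕ → ℕ)
    (hh1 : 1 ≤ h 1 ∧ h 1 ≤ 6) (hh2 : 2 ≤ h 2 ∧ h 2 ≤ 3) (hh3 : h 3 = 3)
    (hh4 : 3 ≤ h 1 → h 2 = 3) :
    LinearIndependent ℝ (fun q : HessSubG h =>
      Ideal.Quotient.mk (IG h)
        ((∏ j ∈ Finset.Icc (q.1.1 + 1) (h 1), alG1 j) *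
          ∏ j ∈ Finset.Icc (q.1.2 + 1) (h 2), alG2 j)) := by
  obtain h2 | h2 : h 2 = 2 ∨ h 2 = 3 := by omega
  · exact dual_linearIndependent_two h (by omega) h2
  · exact dual_linearIndependent_three h hh1 h2
end
end
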